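/- arXiv:1911.03968 — 2 statements merged into one kernel-verified Lean document; each statement's English description precedes it below -/
import Mathlib

section
/- (Modular equation of level 2 and degree 29.) For every real q with 0 < q < 1, P(u(q), v(q)) = 0, where beta = x_2(q), alpha = x_2(q^{29}), u(q) = \sqrt{alpha*beta}, v(q) = \sqrt{(1-alpha)(1-beta)}, and P(X,Y) is the explicit symmetric integer polynomial of total degree 15 given in the context. -/
set_option maxHeartbeats 2000000

/-- The level-2 modular function `x₂(q) = 64q / (64q + ∏_{n≥1} (1+qⁿ)⁻²⁴)`. -/
noncomputable def x₂ (q : ℝ) : ℝ :=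
  64 * q / (64 * q + ∏' n : ℕ, (1 + q ^ (n + 1)) ^ (-24 : ℤ))

/-- The explicit symmetric polynomial `P(u,v)` of the level-2, degree-29 modular
equation, as a function of two real variables. -/
noncomputable def P (u v : ℝ) : ℝ :=
    (u ^ 15 + v ^ 15)
    + 7592191322114338383 * (u ^ 14 * v + u * v ^ 14)
    - 13966622568597353694807 * (u ^ 13 * v ^ 2 + u ^ 2 * v ^ 13)
    + 9843439764837190416529735 * (u ^ 12 * v ^ 3 + u ^ 3 * v ^ 12)
    - 88050856195217696119713579 * (u ^ 11 * v ^ 4 + u ^ 4 * v ^ 11)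
    + 264881102454684464005109883 * (u ^ 10 * v ^ 5 + u ^ 5 * v ^ 10)
    - 339110438936155583303166131 * (u ^ 9 * v ^ 6 + u ^ 6 * v ^ 9)
    + 327822432596177883480907299 * (u ^ 8 * v ^ 7 + u ^ 7 * v ^ 8)
    - 15 * (u ^ 14 + v ^ 14)
    + 44151100393296850926 * (u ^ 13 * v + u * v ^ 13)
    - 80115946613390952012885 * (u ^ 12 * v ^ 2 + u ^ 2 * v ^ 12)
    + 8651254491779851942902828 * (u ^ 11 * v ^ 3 + u ^ 3 * v ^ 11)
    - 49687685907032270183445927 * (u ^ 10 * v ^ 4 + u ^ 4 * v ^ 10)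
    + 7325412196773386395291122 * (u ^ 9 * v ^ 5 + u ^ 5 * v ^ 9)
    + 912734483936820578936054283 * (u ^ 8 * v ^ 6 + u ^ 6 * v ^ 8)
    - 749739327649930298909414424 * (u ^ 7 * v ^ 7)
    + 105 * (u ^ 13 + v ^ 13)
    + 111337818333508248789 * (u ^ 12 * v + u * v ^ 12)
    - 74674720936182298092930 * (u ^ 11 * v ^ 2 + u ^ 2 * v ^ 11)
    - 13575976708893635268568626 * (u ^ 10 * v ^ 3 + u ^ 3 * v ^ 10)
    + 175519360241020438387389123 * (u ^ 9 * v ^ 4 + u ^ 4 * v ^ 9)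
    - 22578235036725232913012001 * (u ^ 8 * v ^ 5 + u ^ 5 * v ^ 8)
    + 685632655975243084716955860 * (u ^ 7 * v ^ 6 + u ^ 6 * v ^ 7)
    - 455 * (u ^ 12 + v ^ 12)
    + 159561487140115731244 * (u ^ 11 * v + u * v ^ 11)
    + 174695780104364520734642 * (u ^ 10 * v ^ 2 + u ^ 2 * v ^ 10)
    - 11101813741117032499783812 * (u ^ 9 * v ^ 3 + u ^ 3 * v ^ 9)
    + 201075954132759831412608055 * (u ^ 8 * v ^ 4 + u ^ 4 * v ^ 8)
    + 349154723555304342205053272 * (u ^ 7 * v ^ 5 + u ^ 5 * v ^ 7)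
    + 120037255935309848803783612 * (u ^ 6 * v ^ 6)
    + 1365 * (u ^ 11 + v ^ 11)
    + 143135164756761661287 * (u ^ 10 * v + u * v ^ 10)
    + 283824735558969676013571 * (u ^ 9 * v ^ 2 + u ^ 2 * v ^ 9)
    + 2841283696852964184955593 * (u ^ 8 * v ^ 3 + u ^ 3 * v ^ 8)
    - 5667068077333965779571054 * (u ^ 7 * v ^ 4 + u ^ 4 * v ^ 7)
    + 191014637062060944039908838 * (u ^ 6 * v ^ 5 + u ^ 5 * v ^ 6)
    - 3003 * (u ^ 10 + v ^ 10)
    + 83485085314001444082 * (u ^ 9 * v + u * v ^ 9)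
    - 14149343647392627703263 * (u ^ 8 * v ^ 2 + u ^ 2 * v ^ 8)
    + 1959056070055873652195160 * (u ^ 7 * v ^ 3 + u ^ 3 * v ^ 7)
    - 97551625043690470733963622 * (u ^ 6 * v ^ 4 + u ^ 4 * v ^ 6)
    - 46531375515452749172936340 * (u ^ 5 * v ^ 5)
    + 5005 * (u ^ 9 + v ^ 9)
    + 31881828039654884597 * (u ^ 8 * v + u * v ^ 8)
    - 167490774279805805587756 * (u ^ 7 * v ^ 2 + u ^ 2 * v ^ 7)
    + 2819912808713121841341252 * (u ^ 6 * v ^ 3 + u ^ 3 * v ^ 6)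
    - 26167312382917423680651674 * (u ^ 5 * v ^ 4 + u ^ 4 * v ^ 5)
    - 6435 * (u ^ 8 + v ^ 8)
    + 7844529197113035240 * (u ^ 7 * v + u * v ^ 7)
    - 30988952407873752960468 * (u ^ 6 * v ^ 2 + u ^ 2 * v ^ 6)
    + 3116654341158724299627864 * (u ^ 5 * v ^ 3 + u ^ 3 * v ^ 5)
    + 1924699491602248664685678 * (u ^ 4 * v ^ 4)
    + 6435 * (u ^ 7 + v ^ 7)
    + 1196071300121674677 * (u ^ 6 * v + u * v ^ 6)
    + 20439274318981208511135 * (u ^ 5 * v ^ 2 + u ^ 2 * v ^ 5)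
    + 712650893196916561319241 * (u ^ 4 * v ^ 3 + u ^ 3 * v ^ 4)
    - 5005 * (u ^ 6 + v ^ 6)
    + 105608490494850034 * (u ^ 5 * v + u * v ^ 5)
    - 1295519266509406265411 * (u ^ 4 * v ^ 2 + u ^ 2 * v ^ 4)
    + 16061879206164618424444 * (u ^ 3 * v ^ 3)
    + 3003 * (u ^ 5 + v ^ 5)
    + 4830887024610855 * (u ^ 4 * v + u * v ^ 4)
    + 14111349703986483150 * (u ^ 3 * v ^ 2 + u ^ 2 * v ^ 3)
    - 1365 * (u ^ 4 + v ^ 4)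
    + 94634825344812 * (u ^ 3 * v + u * v ^ 3)
    - 17548052640024318 * (u ^ 2 * v ^ 2)
    + 455 * (u ^ 3 + v ^ 3)
    + 549304034965 * (u ^ 2 * v + u * v ^ 2)
    - 105 * (u ^ 2 + v ^ 2)
    + 368941806 * (u * v)
    + 15 * (u + v)
    - 1

open Filter Asymptotics Polynomial Topology

/-- `f` agrees with an integer polynomial in `x` up to `O(x ^ N)`, where the polynomial has the sum
of the absolute values of its coefficients at most `B` and takes the value `r` at `2 ^ K` modulo
`2 ^ (K * N)`. -/
def Approx {α : Type*} (l : Filter α) (x : α → ℂ) (K N : ℕ) (f : α → ℂ) (B : ℕ)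
    (r : ZMod (2 ^ (K * N))) : Prop :=
  ∃ (p : ℤ[X]) (m : ℕ[X]), (f - fun t ↦ aeval (x t) p) =O[l] (fun t ↦ x t ^ N) ∧
    (∀ i, (p.coeff i).natAbs ≤ m.coeff i) ∧ m.eval 1 ≤ B ∧ ((p.eval (2 ^ K) : ℤ) : ZMod _) = r

namespace Approx

variable {α : Type*} {l : Filter α} {x : α → ℂ} {K N : ℕ} {f g : α → ℂ} {B C : ℕ}
  {r s : ZMod (2 ^ (K * N))}

lemma X_pow_dvd_of_eval {p : ℤ[X]} (hp : ∀ i, (p.coeff i).natAbs < 2 ^ K)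
    (h : ((2 ^ K) ^ N : ℤ) ∣ p.eval (2 ^ K)) : ∀ n ≤ N, X ^ n ∣ p := by
  intro n
  induction n with
  | zero => simp
  | succ n ih =>
    intro hn
    obtain ⟨g, rfl⟩ := ih (by omega)
    have hg : (2 ^ K : ℤ) ∣ g.eval (2 ^ K) := by
      rw [eval_mul, eval_pow, eval_X] at h
      have h2 : ((2 ^ K) ^ n * 2 ^ K : ℤ) ∣ (2 ^ K) ^ n * g.eval (2 ^ K) :=
        (pow_succ (2 ^ K : ℤ) n ▸ pow_dvd_pow (2 ^ K : ℤ) hn).trans h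
      exact Int.dvd_of_mul_dvd_mul_left (by positivity) h2
    have h0 : (2 ^ K : ℤ) ∣ g.coeff 0 := by
      have := g.sub_dvd_eval_sub (2 ^ K) 0
      rw [sub_zero, ← coeff_zero_eq_eval_zero] at this
      exact (dvd_sub_right hg).mp this
    have hc : (g.coeff 0).natAbs < 2 ^ K := by
      simpa [coeff_X_pow_mul'] using hp n
    have : g.coeff 0 = 0 := by
      refine Int.eq_zero_of_abs_lt_dvd h0 ?_
      rw [Int.abs_eq_natAbs]; exact_mod_cast hc
    rw [pow_succ]
    exact mul_dvd_mul_left _ (X_dvd_iff.mpr this)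

lemma isBigO (hx : Tendsto x l (𝓝 0)) (h : Approx l x K N f B 0) (hB : B < 2 ^ K) :
    f =O[l] (fun t ↦ x t ^ N) := by
  obtain ⟨p, m, h1, h2, h3, h4⟩ := h
  have hd : X ^ N ∣ p := by
    refine X_pow_dvd_of_eval (K := K) (fun i ↦ ?_) ?_ N le_rfl
    · refine (h2 i).trans_lt (lt_of_le_of_lt ?_ hB)
      refine le_trans ?_ h3
      rw [eval_eq_sum_range]
      by_cases hi : i ≤ m.natDegree
      · simpa using Finset.single_le_sum (f := fun i ↦ m.coeff i) (fun _ _ ↦ Nat.zero_le _)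
          (Finset.mem_range.mpr (Nat.lt_succ_of_le hi))
      · simp [coeff_eq_zero_of_natDegree_lt (not_le.mp hi)]
    · have := (ZMod.intCast_zmod_eq_zero_iff_dvd _ _).mp h4
      rw [← pow_mul]; exact_mod_cast this
  obtain ⟨g, rfl⟩ := hd
  have hb : (fun t ↦ aeval (x t) g) =O[l] (fun _ ↦ (1 : ℂ)) :=
    (((g.continuous_aeval (A := ℂ)).tendsto _).comp hx).isBigO_one ℂ
  have := (isBigO_refl (fun t ↦ x t ^ N) l).mul hb
  simp only [mul_one] at this
  refine (h1.add this).congr_left fun t ↦ ?_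
  simp

lemma of_isBigO (h : Approx l x K N f B r) (hfg : (g - f) =O[l] (fun t ↦ x t ^ N)) :
    Approx l x K N g B r := by
  obtain ⟨p, m, h1, h2⟩ := h
  exact ⟨p, m, (hfg.add h1).congr_left fun t ↦ by simp, h2⟩

lemma mono (h : Approx l x K N f B r) (hBC : B ≤ C) : Approx l x K N f C r := by
  obtain ⟨p, m, h1, h2, h3, h4⟩ := h
  exact ⟨p, m, h1, h2, h3.trans hBC, h4⟩

lemma congr_residue (h : Approx l x K N f B r) (hs : r = s) : Approx l x K N f B s :=
  hs ▸ h

lemma const (n : ℤ) : Approx l x K N (fun _ ↦ (n : ℂ)) n.natAbs n := by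
  refine ⟨C n, C n.natAbs, ?_, fun i ↦ ?_, by simp, by simp⟩
  · exact (isBigO_zero _ _).congr_left fun t ↦ by simp
  · simp only [coeff_C]
    split_ifs <;> simp

lemma var : Approx l x K N x 1 (2 ^ K) := by
  refine ⟨X, X, ?_, fun i ↦ ?_, by simp, by simp⟩
  · exact (isBigO_zero _ _).congr_left fun t ↦ by simp
  · simp only [coeff_X]
    split_ifs <;> simp

lemma add (hf : Approx l x K N f B r) (hg : Approx l x K N g C s) :
    Approx l x K N (fun t ↦ f t + g t) (B + C) (r + s) := by
  obtain ⟨p, m, h1, h2, h3, h4⟩ := hf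
  obtain ⟨p', m', h1', h2', h3', h4'⟩ := hg
  refine ⟨p + p', m + m', ?_, fun i ↦ ?_, ?_, ?_⟩
  · refine (h1.add h1').congr_left fun t ↦ ?_
    simp only [Pi.sub_apply, map_add]; ring
  · simpa using (Int.natAbs_add_le _ _).trans (add_le_add (h2 i) (h2' i))
  · simpa using add_le_add h3 h3'
  · simp [← h4, ← h4']

lemma mul (hx : Tendsto x l (𝓝 0)) (hf : Approx l x K N f B r) (hg : Approx l x K N g C s) :
    Approx l x K N (fun t ↦ f t * g t) (B * C) (r * s) := by
  obtain ⟨p, m, h1, h2, h3, h4⟩ := hf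
  obtain ⟨p', m', h1', h2', h3', h4'⟩ := hg
  have hb (p : ℤ[X]) : (fun t ↦ aeval (x t) p) =O[l] (fun _ ↦ (1 : ℂ)) :=
    (((p.continuous_aeval (A := ℂ)).tendsto _).comp hx).isBigO_one ℂ
  have hN : (fun t ↦ x t ^ N) =O[l] (fun _ ↦ (1 : ℂ)) := ((hx.pow N)).isBigO_one ℂ
  have hg1 : g =O[l] (fun _ ↦ (1 : ℂ)) := by
    simpa using ((h1'.trans hN).add (hb p'))
  refine ⟨p * p', m * m', ?_, fun i ↦ ?_, ?_, ?_⟩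
  · have e1 := h1.mul hg1
    have e2 := (hb p).mul h1'
    simp only [mul_one, one_mul] at e1 e2
    refine (e1.add e2).congr_left fun t ↦ ?_
    simp only [Pi.sub_apply, map_mul]; ring
  · rw [coeff_mul, coeff_mul]
    refine (Int.natAbs_sum_le _ _).trans (Finset.sum_le_sum fun j _ ↦ ?_)
    rw [Int.natAbs_mul]
    exact Nat.mul_le_mul (h2 _) (h2' _)
  · simpa using Nat.mul_le_mul h3 h3'
  · simp [← h4, ← h4']

lemma pow (hx : Tendsto x l (𝓝 0)) (hf : Approx l x K N f B r) (n : ℕ) :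
    Approx l x K N (fun t ↦ f t ^ n) (B ^ n) (r ^ n) := by
  induction n with
  | zero => simpa using const (l := l) (x := x) (K := K) (N := N) 1
  | succ n ih => simpa only [pow_succ] using ih.mul hx hf

end Approx

section Evaluation

variable {R : Type*} [CommSemiring R]

/-- The value at `x` of the sparse polynomial given by a list of coefficients and exponents. -/
def sparseEval (c : ℤ → R) (L : List (ℤ × ℕ)) (x : R) : R :=
  L.foldr (fun t s ↦ c t.1 * x ^ t.2 + s) 0

/-- A binary form in `y`, `z` given by its coefficients, together with a power of `z`. -/
def rowEval (c : ℤ → R) (y z : R) (L : List ℤ) : R × R :=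
  L.foldr (fun p s ↦ (c p * s.2 + y * s.1, z * s.2)) (0, 1)

/-- A ternary form in `x`, `y`, `z` given by its rows of coefficients. -/
def formEval (c : ℤ → R) (L : List (List ℤ)) (x y z : R) : R :=
  L.foldr (fun row s ↦ (rowEval c y z row).1 + x * s) 0

end Evaluation

namespace Approx

variable {α : Type*} {l : Filter α} {x : α → ℂ} {K N : ℕ} {f g h : α → ℂ} {A B C : ℕ}
  {q r s : ZMod (2 ^ (K * N))}

lemma sparseEval (hx : Tendsto x l (𝓝 0)) (hf : Approx l x K N f A q) (L : List (ℤ × ℕ)) :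
    Approx l x K N (fun t ↦ sparseEval Int.cast L (f t)) (_root_.sparseEval Int.natAbs L A)
      (_root_.sparseEval Int.cast L q) := by
  induction L with
  | nil => simpa [_root_.sparseEval] using const (l := l) (x := x) (K := K) (N := N) 0
  | cons a L ih => exact ((const a.1).mul hx (hf.pow hx a.2)).add ih

lemma rowEval (hx : Tendsto x l (𝓝 0)) (hf : Approx l x K N f A q) (hg : Approx l x K N g B r)
    (L : List ℤ) :
    Approx l x K N (fun t ↦ (rowEval Int.cast (f t) (g t) L).1)
      (_root_.rowEval Int.natAbs A B L).1 (_root_.rowEval Int.cast q r L).1 ∧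
    Approx l x K N (fun t ↦ (_root_.rowEval Int.cast (f t) (g t) L).2)
      (_root_.rowEval Int.natAbs A B L).2 (_root_.rowEval Int.cast q r L).2 := by
  induction L with
  | nil =>
    exact ⟨by simpa [_root_.rowEval] using const (l := l) (x := x) (K := K) (N := N) 0,
      by simpa [_root_.rowEval] using const (l := l) (x := x) (K := K) (N := N) 1⟩
  | cons a L ih => exact ⟨((const a).mul hx ih.2).add (hf.mul hx ih.1), hg.mul hx ih.2⟩

lemma formEval (hx : Tendsto x l (𝓝 0)) (hf : Approx l x K N f A q) (hg : Approx l x K N g B r)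
    (hh : Approx l x K N h C s) (L : List (List ℤ)) :
    Approx l x K N (fun t ↦ formEval Int.cast L (f t) (g t) (h t))
      (_root_.formEval Int.natAbs L A B C) (_root_.formEval Int.cast L q r s) := by
  induction L with
  | nil => simpa [_root_.formEval] using const (l := l) (x := x) (K := K) (N := N) 0
  | cons a L ih => exact (rowEval hx hg hh a).1.add (hf.mul hx ih)

end Approx

/-- The coefficients of `u ^ i * v ^ j` in the modular polynomial, row by row. -/
def modularRows : List (List ℤ) :=
  [[-1, 15, -105, 455, -1365, 3003, -5005, 6435, -6435, 5005, -3003, 1365, -455, 105, -15, 1],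
   [15, 368941806, 549304034965, 94634825344812, 4830887024610855, 105608490494850034,
    1196071300121674677, 7844529197113035240, 31881828039654884597, 83485085314001444082,
    143135164756761661287, 159561487140115731244, 111337818333508248789,
    44151100393296850926, 7592191322114338383],
   [-105, 549304034965, -17548052640024318, 14111349703986483150, -1295519266509406265411,
    20439274318981208511135, -30988952407873752960468, -167490774279805805587756,
    -14149343647392627703263, 283824735558969676013571, 174695780104364520734642,
    -74674720936182298092930, -80115946613390952012885, -13966622568597353694807],
   [455, 94634825344812, 14111349703986483150, 16061879206164618424444,
    712650893196916561319241, 3116654341158724299627864, 2819912808713121841341252,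
    1959056070055873652195160, 2841283696852964184955593, -11101813741117032499783812,
    -13575976708893635268568626, 8651254491779851942902828, 9843439764837190416529735],
   [-1365, 4830887024610855, -1295519266509406265411, 712650893196916561319241,
    1924699491602248664685678, -26167312382917423680651674, -97551625043690470733963622,
    -5667068077333965779571054, 201075954132759831412608055, 175519360241020438387389123,
    -49687685907032270183445927, -88050856195217696119713579],
   [3003, 105608490494850034, 20439274318981208511135, 3116654341158724299627864,
    -26167312382917423680651674, -46531375515452749172936340, 191014637062060944039908838,
    349154723555304342205053272, -22578235036725232913012001, 7325412196773386395291122,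
    264881102454684464005109883],
   [-5005, 1196071300121674677, -30988952407873752960468, 2819912808713121841341252,
    -97551625043690470733963622, 191014637062060944039908838, 120037255935309848803783612,
    685632655975243084716955860, 912734483936820578936054283, -339110438936155583303166131],
   [6435, 7844529197113035240, -167490774279805805587756, 1959056070055873652195160,
    -5667068077333965779571054, 349154723555304342205053272, 685632655975243084716955860,
    -749739327649930298909414424, 327822432596177883480907299],
   [-6435, 31881828039654884597, -14149343647392627703263, 2841283696852964184955593,
    201075954132759831412608055, -22578235036725232913012001, 912734483936820578936054283,
    327822432596177883480907299],
   [5005, 83485085314001444082, 283824735558969676013571, -11101813741117032499783812,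
    175519360241020438387389123, 7325412196773386395291122, -339110438936155583303166131],
   [-3003, 143135164756761661287, 174695780104364520734642, -13575976708893635268568626,
    -49687685907032270183445927, 264881102454684464005109883],
   [1365, 159561487140115731244, -74674720936182298092930, 8651254491779851942902828,
    -88050856195217696119713579],
   [-455, 111337818333508248789, -80115946613390952012885, 9843439764837190416529735],
   [105, 44151100393296850926, -13966622568597353694807],
   [-15, 7592191322114338383],
   [1]]

/-- The terms of the pentagonal number series below degree 451. -/
def pentagonalTerms : List (ℤ × ℕ) :=
  (1, 0) :: ((List.range 17).map fun k ↦ [((-1) ^ (k + 1), (k + 1) * (3 * k + 2) / 2),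
    ((-1) ^ (k + 1), (k + 1) * (3 * k + 4) / 2)]).flatten

/-- The terms of the `q`-expansion of `2 E₂(2τ) - E₂(τ)` below degree 451. -/
def eisensteinTerms : List (ℤ × ℕ) :=
  (1, 0) :: (List.range 450).map fun n ↦
    (24 * (((List.range (n + 2)).filter fun d ↦ d % 2 == 1 && (n + 1) % d == 0).sum : ℕ), n + 1)

namespace KernelEval

/-- Application of a function, arranged so that the kernel evaluates the argument first. -/
def force {β : Type*} (n : ℕ) (f : ℕ → β) : β :=
  Nat.rec (f 0) (fun k _ ↦ f k.succ) n

@[simp] lemma force_eq {β : Type*} (n : ℕ) (f : ℕ → β) : force n f = f n := by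
  cases n <;> rfl

/-- Reduction modulo `2 ^ L`. -/
def red (L a : ℕ) : ℕ := Nat.land a (2 ^ L - 1)

@[simp] lemma cast_red (L a : ℕ) : (red L a : ZMod (2 ^ L)) = a := by
  rw [red, show Nat.land a (2 ^ L - 1) = a % 2 ^ L from Nat.and_two_pow_sub_one_eq_mod a L,
    ZMod.natCast_mod]

/-- The residue of an integer modulo `2 ^ L`, for integers larger than `-2 ^ L`. -/
def residue (L : ℕ) : ℤ → ℕ
  | .ofNat n => n
  | .negSucc n => (2 ^ L - 1) * n.succ

@[simp] lemma cast_residue (L : ℕ) (a : ℤ) : (residue L a : ZMod (2 ^ L)) = a := by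
  cases a with
  | ofNat n => simp [residue]
  | negSucc n =>
    have : ((2 ^ L : ℕ) : ZMod (2 ^ L)) = 0 := ZMod.natCast_self _
    simp only [residue, Nat.cast_mul, Nat.cast_pred (Nat.two_pow_pos L), this, Int.negSucc_eq]
    push_cast
    ring

/-- The value of a sparse polynomial at `2 ^ M`, added to `a`, modulo `2 ^ L`. -/
def sparse (L M : ℕ) : List (ℤ × ℕ) → ℕ → ℕ
  | [], a => a
  | t :: T, a => bif Nat.ble L (M * t.2) then sparse L M T a else
      force (red L (residue L t.1 * 2 ^ (M * t.2) + a)) (sparse L M T)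

lemma cast_sparse (L M : ℕ) (T : List (ℤ × ℕ)) (a : ℕ) :
    (sparse L M T a : ZMod (2 ^ L)) = sparseEval Int.cast T (2 ^ M) + a := by
  induction T generalizing a with
  | nil => simp [sparse, sparseEval]
  | cons t T ih =>
    have h0 (h : L ≤ M * t.2) : (2 : ZMod (2 ^ L)) ^ (M * t.2) = 0 := by
      have : ((2 ^ L : ℕ) : ZMod (2 ^ L)) = 0 := ZMod.natCast_self _
      rw [← Nat.add_sub_cancel' h, pow_add]
      rw [Nat.cast_pow, Nat.cast_ofNat] at this
      rw [this, zero_mul]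
    simp only [sparse, force_eq]
    rw [show sparseEval Int.cast (t :: T) (2 ^ M : ZMod (2 ^ L)) =
      t.1 * (2 ^ M) ^ t.2 + sparseEval Int.cast T (2 ^ M) from rfl, ← pow_mul]
    cases hb : Nat.ble L (M * t.2)
    · rw [cond_false, ih]
      simp
      ring
    · rw [cond_true, ih, h0 (Nat.le_of_ble_eq_true hb)]
      simp

/-- The value of a binary form together with a power, passed to a continuation. -/
def row (L y z : ℕ) : List ℤ → (ℕ → ℕ → ℕ) → ℕ
  | [], k => k 0 1
  | p :: T, k => row L y z T fun v w ↦
      force (red L (residue L p * w + y * v)) fun v' ↦ force (red L (z * w)) fun w' ↦ k v' w'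

lemma exists_row (L y z : ℕ) (T : List ℤ) : ∃ v w, (∀ k, row L y z T k = k v w) ∧
    (v : ZMod (2 ^ L)) = (rowEval Int.cast (y : ZMod (2 ^ L)) z T).1 ∧
    (w : ZMod (2 ^ L)) = (rowEval Int.cast (y : ZMod (2 ^ L)) z T).2 := by
  induction T with
  | nil => exact ⟨0, 1, fun _ ↦ rfl, by simp [rowEval], by simp [rowEval]⟩
  | cons p T ih =>
    obtain ⟨v, w, hk, hv, hw⟩ := ih
    refine ⟨red L (residue L p * w + y * v), red L (z * w), fun k ↦ ?_, ?_, ?_⟩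
    · simp [row, hk]
    · simp [rowEval] at *
      simp [hv, hw]
    · simp [rowEval] at *
      simp [hw]

/-- The value of a ternary form modulo `2 ^ L`, passed to a continuation. -/
def form (L x y z : ℕ) : List (List ℤ) → (ℕ → ℕ) → ℕ
  | [], k => k 0
  | T :: S, k => form L x y z S fun a ↦ row L y z T fun v _ ↦ force (red L (v + x * a)) k

lemma exists_form (L x y z : ℕ) (S : List (List ℤ)) : ∃ v, (∀ k, form L x y z S k = k v) ∧
    (v : ZMod (2 ^ L)) = formEval Int.cast S (x : ZMod (2 ^ L)) y z := by
  induction S with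
  | nil => exact ⟨0, fun _ ↦ rfl, by simp [formEval]⟩
  | cons T S ih =>
    obtain ⟨a, ha, ha'⟩ := ih
    obtain ⟨v, w, hk, hv, -⟩ := exists_row L y z T
    refine ⟨red L (v + x * a), fun k ↦ by simp [form, ha, hk], ?_⟩
    simp [formEval] at *
    simp [hv, ha']

lemma cast_form (L x y z : ℕ) (S : List (List ℤ)) :
    (form L x y z S id : ZMod (2 ^ L)) = formEval Int.cast S (x : ZMod (2 ^ L)) y z := by
  obtain ⟨v, hk, hv⟩ := exists_form L x y z S
  rw [hk, id, hv]

/-- `a ^ n` modulo `2 ^ L`. -/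
def power (L a n : ℕ) : ℕ :=
  Nat.rec 1 (fun _ r ↦ force r fun r ↦ red L (a * r)) n

@[simp] lemma cast_power (L a n : ℕ) : (power L a n : ZMod (2 ^ L)) = a ^ n := by
  induction n with
  | zero => simp [power]
  | succ n ih =>
    rw [show power L a (n + 1) = force (power L a n) fun r ↦ red L (a * r) from rfl]
    rw [force_eq, cast_red, Nat.cast_mul, ih, pow_succ, mul_comm]

/-- The product of `1 - 2 ^ (K * (i + 1))` for `i < n`, modulo `2 ^ L`. -/
def product (L K n : ℕ) : ℕ :=
  Nat.rec 1 (fun i r ↦ force r fun r ↦ red L (r * (2 ^ L + 1 - 2 ^ (K * i.succ)))) n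

lemma cast_product (K N n : ℕ) (h : n ≤ N) :
    (product (K * N) K n : ZMod (2 ^ (K * N))) = ∏ i ∈ Finset.range n, (1 - (2 ^ K) ^ (i + 1)) := by
  induction n with
  | zero => simp [product]
  | succ n ih =>
    rw [show product (K * N) K (n + 1) = force (product (K * N) K n) fun r ↦
      red (K * N) (r * (2 ^ (K * N) + 1 - 2 ^ (K * n.succ))) from rfl]
    have h1 : 2 ^ (K * n.succ) ≤ 2 ^ (K * N) + 1 :=
      (Nat.pow_le_pow_right two_pos (Nat.mul_le_mul_left K h)).trans (Nat.le_succ _)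
    have h2 : ((2 ^ (K * N) : ℕ) : ZMod (2 ^ (K * N))) = 0 := ZMod.natCast_self _
    rw [force_eq, cast_red, Finset.prod_range_succ, Nat.cast_mul, ih (by omega), Nat.cast_sub h1,
      Nat.cast_add, h2]
    simp [pow_mul]

end KernelEval

open KernelEval

lemma product_eq_pentagonal :
    red (460 * 451) (product (460 * 451) 460 451 +
      (2 ^ (460 * 451) - 1) * sparse (460 * 451) 460 pentagonalTerms 0) = 0 := by
  decide +kernel

/-- The difference of the two sides of the equation relating Euler products to the Eisenstein series
of weight 2, for truncated series at `2 ^ K`, modulo `2 ^ (K * N)`. -/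
def eisensteinValue (K N : ℕ) : ℕ :=
  force (sparse (K * N) (K * 1) pentagonalTerms 0) fun a ↦
  force (sparse (K * N) (K * 2) pentagonalTerms 0) fun b ↦
  force (sparse (K * N) (K * 1) eisensteinTerms 0) fun c ↦
  force (power (K * N) a 8) fun a' ↦ force (power (K * N) b 8) fun b' ↦
  force (power (K * N) a' 3) fun f ↦ force (power (K * N) b' 3) fun g ↦
  force (red (K * N) (a' * b')) fun d ↦ force (red (K * N) (c * c)) fun e ↦
  red (K * N) (e * d + (2 ^ (K * N) - 1) * (f + 64 * 2 ^ K * g))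

/-- The value of the modular polynomial for truncated series at `2 ^ K`, modulo `2 ^ (K * N)`. -/
def formValue (K N : ℕ) : ℕ :=
  force (sparse (K * N) (K * 1) pentagonalTerms 0) fun a ↦
  force (sparse (K * N) (K * 2) pentagonalTerms 0) fun b ↦
  force (sparse (K * N) (K * 29) pentagonalTerms 0) fun c ↦
  force (sparse (K * N) (K * 58) pentagonalTerms 0) fun d ↦
  force (sparse (K * N) (K * 1) eisensteinTerms 0) fun e ↦
  force (sparse (K * N) (K * 29) eisensteinTerms 0) fun f ↦
  force (red (K * N) (a * c)) fun a' ↦ force (red (K * N) (b * d)) fun b' ↦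
  force (red (K * N) (64 * 2 ^ (K * 15) * power (K * N) b' 12)) fun x ↦
  force (power (K * N) a' 12) fun y ↦
  force (red (K * N) (e * f)) fun e' ↦
  force (red (K * N) (a' * b')) fun f' ↦
  force (red (K * N) (e' * power (K * N) f' 4)) fun z ↦
  form (K * N) x y z modularRows id

lemma eisensteinValue_eq_zero : eisensteinValue 2048 451 = 0 := by
  decide +kernel

lemma formValue_eq_zero : formValue 2048 451 = 0 := by
  decide +kernel

/-- Euler's product. -/
noncomputable def euler (x : ℂ) : ℂ := ∏' n : ℕ, (1 - x ^ (n + 1))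

section Approximation

open KernelEval

lemma multipliable_one_sub_pow_nat_add {x : ℂ} (hx : ‖x‖ < 1) (N : ℕ) :
    Multipliable fun n : ℕ ↦ (1 - x ^ (n + N + 1)) := by
  have : Summable fun n : ℕ ↦ ‖-x ^ (n + N + 1)‖ := by
    simp only [norm_neg, norm_pow]
    simpa [pow_add, mul_assoc] using
      (summable_geometric_of_lt_one (norm_nonneg x) hx).mul_right (‖x‖ ^ N * ‖x‖)
  simpa [sub_eq_add_neg] using multipliable_one_add_of_summable this

lemma norm_tprod_one_sub_pow_sub_one_le {x : ℂ} (hx : ‖x‖ ≤ 1 / 2) (N : ℕ) :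
    ‖∏' n : ℕ, (1 - x ^ (n + N + 1)) - 1‖ ≤ 4 * ‖x‖ ^ N := by
  have hx1 : ‖x‖ < 1 := by linarith
  have hm := multipliable_one_sub_pow_nat_add hx1 N
  have hlim := (hm.hasProd.sub_const 1).norm
  refine le_of_tendsto hlim (Eventually.of_forall fun s ↦ ?_)
  have h1 := s.norm_prod_one_add_sub_one_le (fun n : ℕ ↦ -x ^ (n + N + 1))
  simp only [← sub_eq_add_neg, norm_neg, norm_pow] at h1
  refine h1.trans ?_
  have h2 : ∑ n ∈ s, ‖x‖ ^ (n + N + 1) ≤ ‖x‖ ^ N := by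
    have hs := (summable_geometric_of_lt_one (norm_nonneg x) hx1)
    calc ∑ n ∈ s, ‖x‖ ^ (n + N + 1) = ‖x‖ ^ N * (‖x‖ * ∑ n ∈ s, ‖x‖ ^ n) := by
          rw [Finset.mul_sum, Finset.mul_sum]
          exact Finset.sum_congr rfl fun n _ ↦ by ring
      _ ≤ ‖x‖ ^ N * (1 / 2 * (1 - ‖x‖)⁻¹) := by
          gcongr
          rw [← tsum_geometric_of_lt_one (norm_nonneg x) hx1]
          exact hs.sum_le_tsum _ fun _ _ ↦ by positivity
      _ ≤ ‖x‖ ^ N * 1 := by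
          gcongr
          rw [← div_eq_mul_inv, div_le_one (by linarith)]
          linarith
      _ = ‖x‖ ^ N := mul_one _
  have h3 : ‖x‖ ^ N ≤ 1 := pow_le_one₀ (norm_nonneg x) hx1.le
  have h4 : 0 ≤ ∑ n ∈ s, ‖x‖ ^ (n + N + 1) := by positivity
  have h5 := Real.abs_exp_sub_one_le (x := ∑ n ∈ s, ‖x‖ ^ (n + N + 1))
    (by rw [abs_of_nonneg h4]; linarith)
  rw [abs_of_nonneg h4] at h5
  linarith [le_abs_self (Real.exp (∑ n ∈ s, ‖x‖ ^ (n + N + 1)) - 1)]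

variable {α : Type*} {l : Filter α} {x : α → ℂ}

lemma euler_sub_prod_isBigO (hx : Tendsto x l (𝓝 0)) (N : ℕ) :
    (fun t ↦ euler (x t) - ∏ i ∈ Finset.range N, (1 - x t ^ (i + 1))) =O[l] (fun t ↦ x t ^ N) := by
  have h1 : (fun t ↦ ∏' n : ℕ, (1 - x t ^ (n + N + 1)) - 1) =O[l] (fun t ↦ x t ^ N) := by
    refine IsBigO.of_bound 4 ?_
    filter_upwards [hx.norm.eventually (gt_mem_nhds (by simp : ‖(0 : ℂ)‖ < (1 / 2 : ℝ)))] with t ht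
    simpa using norm_tprod_one_sub_pow_sub_one_le ht.le N
  have h2 : (fun t ↦ ∏ i ∈ Finset.range N, (1 - x t ^ (i + 1))) =O[l] (fun _ ↦ (1 : ℂ)) :=
    (tendsto_finsetProd _ fun i _ ↦ (hx.pow (i + 1)).const_sub 1).isBigO_one ℂ
  have h3 := h2.mul h1
  simp only [one_mul] at h3
  refine h3.congr' ?_ .rfl
  filter_upwards [hx.norm.eventually (gt_mem_nhds (by simp : ‖(0 : ℂ)‖ < 1))] with t ht
  have h4 := Multipliable.prod_mul_tprod_nat_mul' (f := fun n : ℕ ↦ 1 - x t ^ (n + 1)) (k := N)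
    (multipliable_one_sub_pow_nat_add ht N)
  exact (mul_sub_one _ _).trans (congrArg (· - _) h4)

lemma euler_isBigO_of (hx : Tendsto x l (𝓝 0)) {K N : ℕ} (T : List (ℤ × ℕ))
    (h0 : red (K * N) (product (K * N) K N + (2 ^ (K * N) - 1) * sparse (K * N) K T 0) = 0)
    (hB : 2 ^ N + sparseEval Int.natAbs T 1 < 2 ^ K) :
    (fun t ↦ euler (x t) - sparseEval Int.cast T (x t)) =O[l] (fun t ↦ x t ^ N) := by
  have hp (n : ℕ) : Approx l x K N (fun t ↦ ∏ i ∈ Finset.range n, (1 - x t ^ (i + 1)))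
      (2 ^ n) (∏ i ∈ Finset.range n, (1 - (2 ^ K) ^ (i + 1))) := by
    induction n with
    | zero => simpa using Approx.const (l := l) (x := x) (K := K) (N := N) 1
    | succ n ih =>
      have h := ih.mul hx ((Approx.const 1).add
        ((Approx.const (-1)).mul hx (Approx.var.pow hx (n + 1))))
      simp only [Finset.prod_range_succ]
      refine .mono (by simpa [← sub_eq_add_neg] using h) (by simp [pow_succ])
  have h1 := (hp N).add ((Approx.const (-1)).mul hx (Approx.var.sparseEval hx T))
  have h2 : (∏ i ∈ Finset.range N, (1 - (2 ^ K) ^ (i + 1)) + ((-1 : ℤ) : ZMod _) *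
      sparseEval Int.cast T (2 ^ K) : ZMod (2 ^ (K * N))) = 0 := by
    have h := congrArg (Nat.cast : ℕ → ZMod (2 ^ (K * N))) h0
    rw [cast_red, Nat.cast_add, Nat.cast_mul, cast_product _ _ _ le_rfl, cast_sparse,
      Nat.cast_pred (Nat.two_pow_pos _), ZMod.natCast_self] at h
    simpa using h
  rw [h2] at h1
  refine ((euler_sub_prod_isBigO hx N).add (h1.isBigO hx (by simpa using hB))).congr_left
    fun t ↦ ?_
  push_cast
  ring

lemma euler_isBigO (hx : Tendsto x l (𝓝 0)) :
    (fun t ↦ euler (x t) - sparseEval Int.cast pentagonalTerms (x t)) =O[l]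
      (fun t ↦ x t ^ 451) :=
  euler_isBigO_of hx pentagonalTerms product_eq_pentagonal (by decide +kernel)

lemma pow_pow_isBigO (hx : Tendsto x l (𝓝 0)) {m : ℕ} (hm : m ≠ 0) (N : ℕ) :
    (fun t ↦ (x t ^ m) ^ N) =O[l] (fun t ↦ x t ^ N) := by
  simp_rw [← pow_mul]
  refine IsBigO.of_bound 1 ?_
  filter_upwards [hx.norm.eventually (gt_mem_nhds (by simp : ‖(0 : ℂ)‖ < 1))] with t ht
  rw [one_mul, norm_pow, norm_pow]
  exact pow_le_pow_of_le_one (norm_nonneg _) ht.le (by nlinarith [Nat.pos_of_ne_zero hm])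

lemma approx_pow {f : ℂ → ℂ} {T : List (ℤ × ℕ)} {N : ℕ} (K : ℕ) {m : ℕ}
    (hx : Tendsto x l (𝓝 0)) (hm : m ≠ 0) (hf : (fun t ↦ f (x t ^ m) -
      sparseEval Int.cast T (x t ^ m)) =O[l] (fun t ↦ (x t ^ m) ^ N)) :
    Approx l x K N (fun t ↦ f (x t ^ m)) (sparseEval Int.natAbs T 1)
      (sparseEval Int.cast T ((2 ^ K) ^ m)) := by
  have h := ((Approx.var (K := K) (N := N)).pow hx m).sparseEval hx T
  rw [one_pow] at h
  exact h.of_isBigO (hf.trans (pow_pow_isBigO hx hm N))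

lemma approx_euler (K : ℕ) (hx : Tendsto x l (𝓝 0)) {m : ℕ} (hm : m ≠ 0) :
    Approx l x K 451 (fun t ↦ euler (x t ^ m)) 35
      (sparseEval Int.cast pentagonalTerms ((2 ^ K) ^ m)) := by
  have h := approx_pow K hx hm (euler_isBigO (by simpa [hm] using hx.pow m))
  rwa [show sparseEval Int.natAbs pentagonalTerms 1 = 35 by decide +kernel] at h

lemma tendsto_euler (hx : Tendsto x l (𝓝 0)) : Tendsto (fun t ↦ euler (x t)) l (𝓝 1) := by
  have h := (euler_sub_prod_isBigO hx 1).trans_tendsto (by simpa using hx)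
  have h2 : Tendsto (fun t ↦ 1 - x t) l (𝓝 1) := by simpa using hx.const_sub 1
  simpa using h.add h2

lemma cast_sparse_mul (K M N : ℕ) (T : List (ℤ × ℕ)) :
    (sparse (K * N) (K * M) T 0 : ZMod (2 ^ (K * N))) = sparseEval Int.cast T ((2 ^ K) ^ M) := by
  rw [cast_sparse, Nat.cast_zero, add_zero, pow_mul (2 : ZMod _) K M]

lemma eisenstein_isBigO_of (hx : Tendsto x l (𝓝 0)) {c : α → ℂ} (hc : Tendsto c l (𝓝 1))
    (h : ∀ t, c t ^ 2 * euler (x t) ^ 8 * euler (x t ^ 2) ^ 8 =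
      euler (x t) ^ 24 + 64 * x t * euler (x t ^ 2) ^ 24) {K B : ℕ}
    (hE : sparseEval Int.natAbs eisensteinTerms 1 ≤ B)
    (h0 : eisensteinValue K 451 = 0)
    (hB : B ^ 2 * 35 ^ 8 * 35 ^ 8 + (35 ^ 24 + 64 * 35 ^ 24) < 2 ^ K) :
    (fun t ↦ c t - sparseEval Int.cast eisensteinTerms (x t)) =O[l] (fun t ↦ x t ^ 451) := by
  have e1 := approx_euler K hx one_ne_zero
  have e2 := approx_euler K hx two_ne_zero
  have e3 := ((Approx.var (K := K) (N := 451)).sparseEval hx eisensteinTerms).mono hE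
  have h1 := (((e3.pow hx 2).mul hx (e1.pow hx 8)).mul hx (e2.pow hx 8)).add
    ((Approx.const (-1)).mul hx ((e1.pow hx 24).add
      (((Approx.const 64).mul hx Approx.var).mul hx (e2.pow hx 24))))
  have h2 := congrArg (Nat.cast : ℕ → ZMod (2 ^ (K * 451))) h0
  simp only [eisensteinValue, force_eq, cast_red, Nat.cast_add, Nat.cast_mul, cast_power,
    cast_sparse_mul, Nat.cast_pred (Nat.two_pow_pos _), ZMod.natCast_self, Nat.cast_zero] at h2
  have h3 : (fun t ↦ sparseEval Int.cast eisensteinTerms (x t) ^ 2 * euler (x t) ^ 8 *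
      euler (x t ^ 2) ^ 8 - c t ^ 2 * euler (x t) ^ 8 * euler (x t ^ 2) ^ 8) =O[l]
      (fun t ↦ x t ^ 451) := by
    have h4 := h1.congr_residue (s := 0) ?_
    · refine (h4.isBigO hx (by simpa using hB)).congr_left fun t ↦ ?_
      rw [h]
      simp
      ring
    · refine Eq.trans ?_ h2
      simp
      ring
  have hx2 : Tendsto (fun t ↦ x t ^ 2) l (𝓝 0) := by simpa using hx.pow 2
  have h5 : Tendsto (fun t ↦ sparseEval Int.cast eisensteinTerms (x t)) l (𝓝 1) := by
    have : Continuous (fun z : ℂ ↦ sparseEval Int.cast eisensteinTerms z) := by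
      have (T : List (ℤ × ℕ)) : Continuous (fun z : ℂ ↦ sparseEval Int.cast T z) := by
        induction T with
        | nil => exact continuous_const
        | cons a T ih => exact (continuous_const.mul (continuous_pow a.2)).add ih
      exact this _
    have h6 := (this.tendsto 0).comp hx
    have h7 (T : List (ℤ × ℕ)) (hT : ∀ a ∈ T, a.2 ≠ 0) : sparseEval Int.cast T (0 : ℂ) = 0 := by
      induction T with
      | nil => rfl
      | cons a T ih =>
        rw [List.forall_mem_cons] at hT
        change _ * _ + sparseEval Int.cast T (0 : ℂ) = 0
        rw [ih hT.2, zero_pow hT.1]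
        simp
    have h8 : sparseEval Int.cast eisensteinTerms (0 : ℂ) = 1 := by
      change _ * _ + sparseEval Int.cast _ (0 : ℂ) = 1
      rw [h7 _ (by simp)]
      simp
    rwa [h8] at h6
  have h6 : Tendsto (fun t ↦ -((c t + sparseEval Int.cast eisensteinTerms (x t)) * euler (x t) ^ 8 *
      euler (x t ^ 2) ^ 8)) l (𝓝 (-((1 + 1) * 1 ^ 8 * 1 ^ 8))) :=
    (((hc.add h5).mul ((tendsto_euler hx).pow 8)).mul ((tendsto_euler hx2).pow 8)).neg
  have h7 := (h6.inv₀ (by norm_num)).isBigO_one ℂ |>.mul h3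
  simp only [one_mul] at h7
  refine h7.congr' ?_ .rfl
  filter_upwards [h6.eventually_ne (b₂ := 0) (by norm_num)] with t ht
  rw [inv_mul_eq_iff_eq_mul₀ ht]
  ring

lemma eisenstein_isBigO (hx : Tendsto x l (𝓝 0)) {c : α → ℂ} (hc : Tendsto c l (𝓝 1))
    (h : ∀ t, c t ^ 2 * euler (x t) ^ 8 * euler (x t ^ 2) ^ 8 =
      euler (x t) ^ 24 + 64 * x t * euler (x t ^ 2) ^ 24) :
    (fun t ↦ c t - sparseEval Int.cast eisensteinTerms (x t)) =O[l] (fun t ↦ x t ^ 451) :=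
  eisenstein_isBigO_of hx hc h (B := 2 ^ 22) (by decide +kernel) eisensteinValue_eq_zero
    (by decide +kernel)

lemma form_isBigO_of (hx : Tendsto x l (𝓝 0)) {c c' : α → ℂ}
    (hc : (fun t ↦ c t - sparseEval Int.cast eisensteinTerms (x t ^ 1)) =O[l]
      (fun t ↦ (x t ^ 1) ^ 451))
    (hc' : (fun t ↦ c' t - sparseEval Int.cast eisensteinTerms (x t ^ 29)) =O[l]
      (fun t ↦ (x t ^ 29) ^ 451)) {K B : ℕ}
    (hE : sparseEval Int.natAbs eisensteinTerms 1 ≤ B) (h0 : formValue K 451 = 0)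
    (hB : formEval Int.natAbs modularRows (64 * (35 * 35) ^ 12) ((35 * 35) ^ 12)
      (B * B * (35 * 35 * (35 * 35)) ^ 4) < 2 ^ K) :
    (fun t ↦ formEval Int.cast modularRows
      (64 * x t ^ 15 * (euler (x t ^ 2) * euler (x t ^ 58)) ^ 12)
      ((euler (x t) * euler (x t ^ 29)) ^ 12)
      (c t * c' t * (euler (x t) * euler (x t ^ 29) * (euler (x t ^ 2) * euler (x t ^ 58))) ^ 4))
        =O[l] (fun t ↦ x t ^ 451) := by
  have e1 := approx_euler K hx one_ne_zero
  have e2 := approx_euler K hx two_ne_zero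
  have e29 := approx_euler K hx (m := 29) (by norm_num)
  have e58 := approx_euler K hx (m := 58) (by norm_num)
  have hv := (Approx.var (l := l) (x := x) (K := K) (N := 451))
  have f1 := (((hv.pow hx 1).sparseEval hx eisensteinTerms).of_isBigO
    (hc.trans (pow_pow_isBigO hx one_ne_zero _))).mono (by simpa using hE)
  have f29 := (((hv.pow hx 29).sparseEval hx eisensteinTerms).of_isBigO
    (hc'.trans (pow_pow_isBigO hx (by norm_num) _))).mono (by simpa using hE)
  have h1 := Approx.formEval hx
    (((Approx.const 64).mul hx (hv.pow hx 15)).mul hx ((e2.mul hx e58).pow hx 12))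
    ((e1.mul hx e29).pow hx 12)
    ((f1.mul hx f29).mul hx (((e1.mul hx e29).mul hx (e2.mul hx e58)).pow hx 4)) modularRows
  have h2 := congrArg (Nat.cast : ℕ → ZMod (2 ^ (K * 451))) h0
  simp only [formValue, force_eq, cast_form, cast_red, Nat.cast_mul, cast_power,
    cast_sparse_mul, Nat.cast_pow, pow_mul, Nat.cast_ofNat, Nat.cast_zero] at h2
  have h4 := h1.congr_residue (s := 0) ?_
  · refine (h4.isBigO hx ?_).congr_left fun t ↦ ?_
    · simpa using hB
    · simp
  · rw [← h2]
    simp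

lemma form_isBigO (hx : Tendsto x l (𝓝 0)) {c c' : α → ℂ}
    (hc : Tendsto c l (𝓝 1)) (hc' : Tendsto c' l (𝓝 1))
    (h : ∀ t, c t ^ 2 * euler (x t) ^ 8 * euler (x t ^ 2) ^ 8 =
      euler (x t) ^ 24 + 64 * x t * euler (x t ^ 2) ^ 24)
    (h' : ∀ t, c' t ^ 2 * euler (x t ^ 29) ^ 8 * euler (x t ^ 58) ^ 8 =
      euler (x t ^ 29) ^ 24 + 64 * x t ^ 29 * euler (x t ^ 58) ^ 24) :
    (fun t ↦ formEval Int.cast modularRows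
      (64 * x t ^ 15 * (euler (x t ^ 2) * euler (x t ^ 58)) ^ 12)
      ((euler (x t) * euler (x t ^ 29)) ^ 12)
      (c t * c' t * (euler (x t) * euler (x t ^ 29) * (euler (x t ^ 2) * euler (x t ^ 58))) ^ 4))
        =O[l] (fun t ↦ x t ^ 451) := by
  refine form_isBigO_of hx (by simpa using eisenstein_isBigO hx hc h)
    (eisenstein_isBigO (by simpa using hx.pow 29) hc' fun t ↦ ?_) (B := 2 ^ 22)
    (by decide +kernel) formValue_eq_zero (by decide +kernel)
  rw [← pow_mul]
  exact h' t

end Approximation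

open UpperHalfPlane hiding I
open ModularForm CongruenceSubgroup Matrix.SpecialLinearGroup
open scoped MatrixGroups Manifold

section Sturm

lemma ModularForm.levelOne_eq_zero_of_isBigO {k : ℤ} (f : ModularForm 𝒮ℒ k) {N : ℕ}
    (hk : k < 12 * N) (hf : f =O[atImInfty] fun τ ↦ Real.exp (-2 * Real.pi * τ.im) ^ N) :
    f = 0 := by
  induction N generalizing k with
  | zero =>
    ext τ
    exact congrFun (ModularFormClass.levelOne_neg_weight_eq_zero (by simpa using hk) f) τ
  | succ N ih =>
    have hE : Tendsto (fun τ : ℍ ↦ Real.exp (-2 * Real.pi * τ.im)) atImInfty (𝓝 0) := by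
      refine Real.tendsto_exp_atBot.comp ?_
      exact tendsto_comap.const_mul_atTop_of_neg (by linarith [Real.pi_pos])
    have h0 : IsZeroAtImInfty f := hf.trans_tendsto (by simpa using hE.pow (N + 1))
    have hc : (qExpansion 1 f).coeff 0 = 0 := by
      rw [UpperHalfPlane.qExpansion_coeff_zero one_pos
        (ModularFormClass.analyticAt_cuspFunction_zero f one_pos one_mem_strictPeriods_SL)
        (SlashInvariantFormClass.periodic_comp_ofComplex f one_mem_strictPeriods_SL)]
      exact h0.valueAtInfty_eq_zero
    suffices CuspForm.discriminantEquiv (toCuspForm f hc) = 0 by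
      simpa [CuspForm.discriminantEquiv.map_eq_zero_iff, DFunLike.ext_iff] using this
    refine ih _ (by push_cast at hk; linarith) ?_
    have h1 := hf.mul (exp_isBigO_discriminant.inv_rev
      (Eventually.of_forall fun τ h ↦ absurd h (Real.exp_pos _).ne'))
    refine IsBigO.congr h1 (fun τ ↦ ?_) fun τ ↦ ?_
    · rw [CuspForm.discriminantEquiv_apply, div_eq_mul_inv]
      rfl
    · rw [pow_succ, mul_assoc, mul_inv_cancel₀ (Real.exp_pos _).ne', mul_one]

theorem eq_zero_of_isBigO (Γ : Subgroup SL(2, ℤ)) [Γ.FiniteIndex] {k : ℤ} {f : ℍ → ℂ}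
    (hol : MDiff f) (inv : ∀ γ ∈ Γ, f ∣[k] γ = f)
    (bdd : ∀ γ : SL(2, ℤ), IsBoundedAtImInfty (f ∣[k] γ)) {N : ℕ} (hN : k * Γ.index < 12 * N)
    (hf : f =O[atImInfty] fun τ : ℍ ↦ Function.Periodic.qParam 1 τ ^ N) : f = 0 := by
  let g : ModularForm (Γ.map (mapGL ℝ)) k :=
    { toFun := f
      slash_action_eq' := by
        rintro _ ⟨γ, hγ, rfl⟩
        exact inv γ hγ
      holo' := hol
      bdd_at_cusps' := fun {c} hc ↦ by
        rw [Subgroup.IsArithmetic.isCusp_iff_isCusp_SL2Z] at hc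
        exact (OnePoint.isBoundedAt_iff_forall_SL2Z hc).mpr fun γ _ ↦ bdd γ }
  have hcard : Nat.card (𝒮ℒ ⧸ (Γ.map (mapGL ℝ)).subgroupOf 𝒮ℒ) = Γ.index := by
    rw [← Subgroup.relIndex_top_right, ← Subgroup.relIndex_map_map_of_injective Γ ⊤
      (mapGL_injective (S := ℝ)), ← MonoidHom.range_eq_map]
    rfl
  have h1 : ModularForm.norm 𝒮ℒ g = 0 := by
    refine ModularForm.levelOne_eq_zero_of_isBigO _ (N := N) (by rwa [hcard]) ?_
    rw [ModularForm.coe_norm]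
    let := Fintype.ofFinite (𝒮ℒ ⧸ (Γ.map (mapGL ℝ)).subgroupOf 𝒮ℒ)
    classical
    have h2 (q : 𝒮ℒ ⧸ (Γ.map (mapGL ℝ)).subgroupOf 𝒮ℒ) :
        SlashInvariantForm.quotientFunc g q =O[atImInfty] (fun _ ↦ (1 : ℝ)) := by
      induction q using Quotient.inductionOn with
      | h r =>
        obtain ⟨_, γ, rfl⟩ := r
        have h : IsBoundedAtImInfty (f ∣[k] (mapGL ℝ γ)⁻¹) := by
          rw [← map_inv]
          exact bdd γ⁻¹
        exact h
    let q₁ : 𝒮ℒ ⧸ (Γ.map (mapGL ℝ)).subgroupOf 𝒮ℒ := QuotientGroup.mk 1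
    change (∏ q, SlashInvariantForm.quotientFunc g q) =O[atImInfty] _
    rw [← Finset.mul_prod_erase Finset.univ (SlashInvariantForm.quotientFunc g)
      (Finset.mem_univ q₁)]
    have h3 : (fun τ : ℍ ↦ Function.Periodic.qParam 1 τ ^ N) =O[atImInfty]
        fun τ ↦ Real.exp (-2 * Real.pi * τ.im) ^ N := by
      refine .of_norm_le fun τ ↦ ?_
      rw [norm_pow, Function.Periodic.norm_qParam]
      simp
    have h4 : (∏ q ∈ Finset.univ.erase q₁, SlashInvariantForm.quotientFunc g q) =O[atImInfty]
        (fun _ ↦ (1 : ℝ)) := by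
      have := IsBigO.finsetProd (s := Finset.univ.erase q₁) (fun q _ ↦ h2 q)
      simpa [Finset.prod_fn] using this
    have h5 : SlashInvariantForm.quotientFunc g q₁ = f := by
      change f ∣[k] ((1 : 𝒮ℒ)⁻¹ : 𝒮ℒ).1 = f
      simp
    rw [h5]
    exact IsBigO.congr_right ((hf.trans h3).mul h4) fun τ ↦ mul_one _
  exact (ModularForm.norm_eq_zero_iff 𝒮ℒ g).mp h1

end Sturm

lemma index_Gamma0_le (p : ℕ) [Fact p.Prime] : (Gamma0 p).index ≤ p + 1 := by
  classical
  let := MulAction.compHom (OnePoint (ZMod p))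
    (toGL.comp (Matrix.SpecialLinearGroup.map (n := Fin 2) (Int.castRingHom (ZMod p))))
  have h : MulAction.stabilizer SL(2, ℤ) (OnePoint.infty : OnePoint (ZMod p)) = Gamma0 p := by
    ext γ
    rw [MulAction.mem_stabilizer_iff, Gamma0_mem]
    exact OnePoint.smul_infty_eq_self_iff
  rw [← h, Subgroup.index_eq_card]
  refine (Finite.card_le_of_embedding
    ((MulAction.orbitEquivQuotientStabilizer _ _).symm.toEmbedding.trans
      (Function.Embedding.subtype _))).trans ?_
  change Nat.card (Option (ZMod p)) ≤ _
  simp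

lemma index_Gamma0_mul_le (p q : ℕ) [Fact p.Prime] [Fact q.Prime] (h : p.Coprime q) :
    (Gamma0 (p * q)).index ≤ (p + 1) * (q + 1) := by
  have h' : Gamma0 (p * q) = Gamma0 p ⊓ Gamma0 q := by
    ext γ
    simp only [Subgroup.mem_inf, Gamma0_mem, fun n ↦ CharP.intCast_eq_zero_iff (ZMod n) n (γ 1 0),
      Nat.cast_mul]
    exact ⟨fun h ↦ ⟨dvd_of_mul_right_dvd h, dvd_of_mul_left_dvd h⟩,
      fun ⟨h1, h2⟩ ↦ h.isCoprime.mul_dvd h1 h2⟩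
  rw [h']
  exact Subgroup.index_inf_le.trans (Nat.mul_le_mul (index_Gamma0_le p) (index_Gamma0_le q))

/-- The linear map `τ ↦ N * τ`, as an invertible matrix. -/
noncomputable def scaling (N : ℕ) [NeZero N] : GL (Fin 2) ℝ :=
  .mkOfDetNeZero !![(N : ℝ), 0; 0, 1] (by simp [NeZero.ne])

section Scaling

variable {N : ℕ} [NeZero N]

lemma coe_scaling : (scaling N).val = !![(N : ℝ), 0; 0, 1] := rfl

lemma det_scaling : (scaling N).det.val = N := by
  rw [Matrix.GeneralLinearGroup.val_det_apply, coe_scaling, Matrix.det_fin_two_of]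
  simp

lemma coe_scaling_smul (τ : ℍ) : (↑(scaling N • τ) : ℂ) = N * τ := by
  rw [coe_smul_of_det_pos (by rw [det_scaling]; exact mod_cast Nat.pos_of_neZero N)]
  simp [num, denom, coe_scaling]

lemma σ_scaling : UpperHalfPlane.σ (scaling N) = .refl ℝ ℂ := by
  rw [σ, det_scaling, if_pos (mod_cast Nat.pos_of_neZero N)]

lemma slash_scaling_apply (k : ℤ) (f : ℍ → ℂ) (τ : ℍ) :
    (f ∣[k] scaling N) τ = N ^ (k - 1) * f (scaling N • τ) := by
  rw [slash_apply, σ_scaling, det_scaling]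
  simp [denom, coe_scaling, mul_comm]

lemma exists_scaling_mul_eq {γ : SL(2, ℤ)} (h : (N : ℤ) ∣ γ 1 0) :
    ∃ γ' : SL(2, ℤ), scaling N * mapGL ℝ γ = mapGL ℝ γ' * scaling N ∧ γ' 0 0 = γ 0 0 ∧
      γ' 0 1 = N * γ 0 1 ∧ γ 1 0 = N * γ' 1 0 ∧ γ' 1 1 = γ 1 1 := by
  obtain ⟨c, hc⟩ := h
  obtain ⟨γ', h⟩ : ∃ γ' : SL(2, ℤ), γ'.val = !![γ 0 0, N * γ 0 1; c, γ 1 1] := by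
    refine ⟨⟨!![γ 0 0, N * γ 0 1; c, γ 1 1], ?_⟩, rfl⟩
    have := γ.det_coe
    rw [Matrix.det_fin_two, hc] at this
    rw [Matrix.det_fin_two_of]
    linarith
  refine ⟨γ', ?_, by simp [h], by simp [h], by simp [h, hc], by simp [h]⟩
  ext i j
  fin_cases i <;> fin_cases j <;> simp [coe_scaling, Matrix.mul_apply, h, hc, mul_comm]

lemma slash_scaling_slash {k : ℤ} (f : ℍ → ℂ) {γ γ' : SL(2, ℤ)}
    (h : scaling N * mapGL ℝ γ = mapGL ℝ γ' * scaling N) :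
    (f ∣[k] scaling N) ∣[k] γ = (f ∣[k] γ') ∣[k] scaling N := by
  change (f ∣[k] scaling N) ∣[k] mapGL ℝ γ = (f ∣[k] mapGL ℝ γ') ∣[k] scaling N
  rw [← SlashAction.slash_mul, h, SlashAction.slash_mul]

lemma smul_slash_scaling (k : ℤ) (c : ℂ) (f : ℍ → ℂ) :
    (c • f) ∣[k] scaling N = c • (f ∣[k] scaling N) := by
  rw [smul_slash, σ_scaling]
  rfl

lemma isBoundedAtImInfty_slash_scaling {k : ℤ} {f : ℍ → ℂ}
    (h : ∀ γ : SL(2, ℤ), IsBoundedAtImInfty (f ∣[k] γ)) (γ : SL(2, ℤ)) :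
    IsBoundedAtImInfty ((f ∣[k] scaling N) ∣[k] γ) := by
  change IsBoundedAtImInfty ((f ∣[k] scaling N) ∣[k] mapGL ℝ γ)
  rw [← SlashAction.slash_mul, ← OnePoint.isBoundedAt_infty_iff, ← OnePoint.IsBoundedAt.smul_iff]
  refine (OnePoint.isBoundedAt_iff_forall_SL2Z ?_).mpr fun γ _ ↦ h γ
  rw [isCusp_SL2Z_iff, OnePoint.smul_infty_eq_ite]
  split_ifs
  · exact ⟨.infty, rfl⟩
  · refine ⟨OnePoint.some (N * γ 0 0 / γ 1 0 : ℚ), ?_⟩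
    simp [coe_scaling, Matrix.mul_apply]

end Scaling

/-- Holomorphic functions on the upper half plane which are bounded at all cusps and which
transform under a subgroup of the modular group with weight `k` and multiplier `χ`. -/
structure IsModular (Γ : Subgroup SL(2, ℤ)) (k : ℤ) (χ : SL(2, ℤ) → ℂ) (f : ℍ → ℂ) : Prop where
  mdiff : MDiff f
  slash_eq : ∀ γ ∈ Γ, f ∣[k] γ = χ γ • f
  bdd : ∀ γ : SL(2, ℤ), IsBoundedAtImInfty (f ∣[k] γ)

namespace IsModular

variable {Γ Γ' : Subgroup SL(2, ℤ)} {k l : ℤ} {χ χ' : SL(2, ℤ) → ℂ} {f g : ℍ → ℂ}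

lemma congr (hf : IsModular Γ k χ f) (h : Γ' ≤ Γ) (hχ : ∀ γ ∈ Γ', χ γ = χ' γ) :
    IsModular Γ' k χ' f :=
  ⟨hf.mdiff, fun γ hγ ↦ by rw [hf.slash_eq γ (h hγ), hχ γ hγ], hf.bdd⟩

lemma add (hf : IsModular Γ k χ f) (hg : IsModular Γ k χ g) : IsModular Γ k χ (f + g) where
  mdiff := hf.mdiff.add hg.mdiff
  slash_eq γ hγ := by rw [SlashAction.add_slash, hf.slash_eq γ hγ, hg.slash_eq γ hγ, smul_add]
  bdd γ := by
    rw [SlashAction.add_slash]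
    exact (hf.bdd γ).add (hg.bdd γ)

lemma smul (c : ℂ) (hf : IsModular Γ k χ f) : IsModular Γ k χ (c • f) where
  mdiff := hf.mdiff.const_smul c
  slash_eq γ hγ := by rw [SL_smul_slash, hf.slash_eq γ hγ, smul_comm]
  bdd γ := by
    rw [SL_smul_slash]
    exact (hf.bdd γ).smul c

lemma mul (hf : IsModular Γ k χ f) (hg : IsModular Γ l χ' g) :
    IsModular Γ (k + l) (χ * χ') (f * g) where
  mdiff := hf.mdiff.mul hg.mdiff
  slash_eq γ hγ := by
    rw [mul_slash_SL2, hf.slash_eq γ hγ, hg.slash_eq γ hγ, smul_mul_smul_comm, Pi.mul_apply]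
  bdd γ := by
    rw [mul_slash_SL2]
    exact (hf.bdd γ).mul (hg.bdd γ)

lemma const (c : ℂ) : IsModular Γ 0 1 (Function.const ℍ c) where
  mdiff := mdifferentiable_const
  slash_eq γ _ := by rw [is_invariant_const, Pi.one_apply, one_smul]
  bdd γ := by
    rw [is_invariant_const]
    exact const_boundedAtFilter _ _

lemma slash_scaling {M N : ℕ} [NeZero N] (hf : IsModular (Gamma0 M) k χ f)
    (hχ : ∀ γ γ' : SL(2, ℤ), γ' 0 1 = N * γ 0 1 → γ 1 0 = N * γ' 1 0 → χ γ' = χ' γ) :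
    IsModular (Gamma0 (M * N)) k χ' (f ∣[k] scaling N) where
  mdiff := hf.mdiff.slash k _
  slash_eq γ hγ := by
    rw [Gamma0_mem, CharP.intCast_eq_zero_iff _ (M * N)] at hγ
    push_cast at hγ
    obtain ⟨γ', h, -, h01, h10, -⟩ := exists_scaling_mul_eq (N := N) (dvd_of_mul_left_dvd hγ)
    rw [h10, mul_comm] at hγ
    have hγ' : γ' ∈ Gamma0 M := by
      rw [Gamma0_mem, CharP.intCast_eq_zero_iff _ M]
      exact Int.dvd_of_mul_dvd_mul_left (by simp [NeZero.ne]) hγ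
    rw [slash_scaling_slash f h, hf.slash_eq γ' hγ', smul_slash_scaling, hχ γ γ' h01 h10]
  bdd := isBoundedAtImInfty_slash_scaling hf.bdd

end IsModular

section Orbit

open ModularGroup

variable {f : ℍ → ℂ}

/-- The slash translates of a form `f` of weight two with `f ∣ T = -f` and `f ∣ S T² = f ∣ S`. -/
noncomputable def slashOrbit (f : ℍ → ℂ) (γ : SL(2, ℤ)) : ℍ → ℂ :=
  if Even (γ 1 0) then (-1 : ℂ) ^ γ 0 1 • f
  else if Even (γ 1 1) then (-1 : ℂ) ^ γ 0 0 • (f ∣[(2 : ℤ)] S)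
  else (-1 : ℂ) ^ γ 0 0 • (f ∣[(2 : ℤ)] (S * T))

lemma slash_two_neg_one (g : ℍ → ℂ) : g ∣[(2 : ℤ)] (-1 : SL(2, ℤ)) = g := by
  ext τ
  simp [SL_slash_apply, denom]

lemma slash_eq_slashOrbit (hT : f ∣[(2 : ℤ)] T = -f)
    (hS : f ∣[(2 : ℤ)] (S * T * T) = f ∣[(2 : ℤ)] S) (γ : SL(2, ℤ)) :
    f ∣[(2 : ℤ)] γ = slashOrbit f γ := by
  have hSS : f ∣[(2 : ℤ)] (S * S) = f := by
    rw [show S * S = -1 by decide, slash_two_neg_one]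
  have hSTS : f ∣[(2 : ℤ)] (S * T * S) = -(f ∣[(2 : ℤ)] (S * T)) := by
    have h : f ∣[(2 : ℤ)] (T * (S * T * S) * T) = f ∣[(2 : ℤ)] (S * T * T) := by
      rw [hS, show T * (S * T * S) * T = S by decide]
    rw [SlashAction.slash_mul, SlashAction.slash_mul, hT, SlashAction.neg_slash,
      SlashAction.slash_mul _ (S * T) T] at h
    have h' := congrArg (fun g ↦ -(g ∣[(2 : ℤ)] T⁻¹)) h
    simp only [← SlashAction.slash_mul, SlashAction.neg_slash, mul_inv_cancel_right, neg_neg] at h'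
    exact h'
  suffices h : ∀ γ δ : SL(2, ℤ), slashOrbit f (δ * γ) = slashOrbit f δ ∣[(2 : ℤ)] γ by
    simpa [slashOrbit] using (h γ 1).symm
  intro γ
  have hγ : γ ∈ Subgroup.closure {S, T} := by
    simp [SpecialLinearGroup.SL2Z_generators]
  induction hγ using Subgroup.closure_induction with
  | one => simp
  | mul x y _ _ hx hy =>
    intro δ
    rw [← mul_assoc, hy, hx, SlashAction.slash_mul]
  | inv x _ hx =>
    intro δ
    have := hx (δ * x⁻¹)
    rw [inv_mul_cancel_right] at this
    rw [this, ← SlashAction.slash_mul, mul_inv_cancel, SlashAction.slash_one]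
  | mem x hx =>
    intro δ
    have hdet := δ.det_coe
    rw [Matrix.det_fin_two] at hdet
    have hdet' := congrArg (Even (α := ℤ)) hdet
    have e (i j) : (δ * x) i j = δ i 0 * x 0 j + δ i 1 * x 1 j := by
      rw [Matrix.SpecialLinearGroup.coe_mul, Matrix.mul_apply, Fin.sum_univ_two]
    have hpow (n : ℤ) : (-1 : ℂ) ^ n = if Even n then 1 else -1 := by
      split_ifs with hn
      · exact hn.neg_one_zpow
      · exact (Int.not_even_iff_odd.mp hn).neg_one_zpow
    by_cases h1 : Even (δ 0 0) <;> by_cases h2 : Even (δ 0 1) <;>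
    by_cases h3 : Even (δ 1 0) <;> by_cases h4 : Even (δ 1 1) <;>
    simp [h1, h2, h3, h4, parity_simps] at hdet' <;> rcases hx with rfl | rfl <;>
    simp [slashOrbit, e, coe_S, coe_T, hpow, h1, h2, h3, h4, ← SlashAction.slash_mul, hSS, hSTS,
      hT, hS, SlashAction.neg_slash, parity_simps]

end Orbit

section EtaQuotient

open ModularGroup

lemma eta_eq_mul_euler (z : ℂ) :
    η z = Function.Periodic.qParam 24 z * euler (Function.Periodic.qParam 1 z) := by
  rfl

lemma eta_add_one (z : ℂ) : η (z + 1) = Complex.exp (Real.pi * Complex.I / 12) * η z := by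
  have h : Function.Periodic.qParam 1 (z + 1) = Function.Periodic.qParam 1 z := by
    simp [Function.Periodic.qParam, mul_add, Complex.exp_add]
  rw [eta_eq_mul_euler, eta_eq_mul_euler, h, ← mul_assoc]
  congr 1
  rw [Function.Periodic.qParam, Function.Periodic.qParam, ← Complex.exp_add]
  congr 1
  push_cast
  ring

lemma eta_neg_one_div_pow_four (τ : ℍ) : η (-1 / τ) ^ 4 = -τ ^ 2 * η τ ^ 4 := by
  have h := eta_comp_eq_csqrt_I_inv τ.2
  have h' {z : ℂ} (hz : z ≠ 0) : Complex.sqrt z ^ 4 = z ^ 2 := by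
    rw [_root_.sqrt_eq_exp hz, ← Complex.exp_nat_mul]
    conv_rhs => rw [← Complex.exp_log hz, ← Complex.exp_nat_mul]
    congr 1
    push_cast
    ring
  simp only [Function.comp_apply, Pi.smul_apply, Pi.mul_apply, smul_eq_mul] at h
  rw [h, mul_pow, mul_pow, inv_pow, h' Complex.I_ne_zero, h' τ.ne_zero, Complex.I_sq]
  ring

/-- The eta quotient `η(2τ)⁸ / η(τ)⁴`. -/
noncomputable def etaQuotient (τ : ℍ) : ℂ := η (2 * τ) ^ 8 / η τ ^ 4

lemma slash_T_apply (k : ℤ) (f : ℍ → ℂ) (τ : ℍ) : (f ∣[k] T) τ = f ((1 : ℝ) +ᵥ τ) := by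
  rw [SL_slash_apply, modular_T_smul]
  simp [denom, coe_T]

lemma etaQuotient_slash_T : etaQuotient ∣[(2 : ℤ)] T = -etaQuotient := by
  ext τ
  have h : Complex.exp (Real.pi * Complex.I / 12) ^ 12 = -1 := by
    rw [← Complex.exp_nat_mul, ← Complex.exp_pi_mul_I]
    congr 1
    push_cast
    ring
  rw [slash_T_apply, Pi.neg_apply, etaQuotient, etaQuotient, coe_vadd,
    show 2 * (((1 : ℝ) : ℂ) + τ) = 2 * τ + 1 + 1 by push_cast; ring, Complex.ofReal_one,
    add_comm 1 (τ : ℂ), eta_add_one, eta_add_one, eta_add_one]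
  have := Complex.exp_ne_zero (Real.pi * Complex.I / 12)
  have := eta_ne_zero τ.2
  field_simp
  linear_combination η (2 * τ) ^ 8 * h

lemma etaQuotient_slash_S (τ : ℍ) :
    (etaQuotient ∣[(2 : ℤ)] S) τ = -(1 / 16) * (η (τ / 2) ^ 8 / η τ ^ 4) := by
  have h := eta_neg_one_div_pow_four τ
  have h2 : 0 < ((τ : ℂ) / 2).im := by
    simpa using τ.im_pos
  have h' := eta_neg_one_div_pow_four ⟨τ / 2, h2⟩
  have h0 := τ.ne_zero
  have h1 := eta_ne_zero τ.2
  have e1 : (-1 / (τ / 2) : ℂ) = 2 * (-(τ : ℂ))⁻¹ := by field_simp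
  have e2 : (-1 / τ : ℂ) = (-(τ : ℂ))⁻¹ := by field_simp
  rw [e2] at h
  change η (-1 / (τ / 2)) ^ 4 = -(τ / 2) ^ 2 * η (τ / 2) ^ 4 at h'
  rw [e1] at h'
  rw [SL_slash_apply, modular_S_smul, etaQuotient, show 8 = 4 * 2 from rfl, pow_mul]
  change (η (2 * (-(τ : ℂ))⁻¹) ^ 4) ^ 2 / η ((-(τ : ℂ))⁻¹) ^ 4 * _ = _
  rw [h, h']
  simp [denom, coe_S]
  field_simp
  ring

lemma etaQuotient_slash_S_mul_T_mul_T :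
    etaQuotient ∣[(2 : ℤ)] (S * T * T) = etaQuotient ∣[(2 : ℤ)] S := by
  ext τ
  rw [SlashAction.slash_mul, SlashAction.slash_mul, slash_T_apply, slash_T_apply,
    etaQuotient_slash_S, etaQuotient_slash_S, coe_vadd, coe_vadd, Complex.ofReal_one,
    show ((1 + (1 + τ) : ℂ)) / 2 = τ / 2 + 1 by ring,
    show (1 + (1 + τ) : ℂ) = τ + 1 + 1 by ring, eta_add_one, eta_add_one, eta_add_one]
  have := Complex.exp_ne_zero (Real.pi * Complex.I / 12)
  have := eta_ne_zero τ.2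
  field_simp

lemma etaQuotient_mdifferentiable : MDiff etaQuotient := by
  rw [UpperHalfPlane.mdifferentiable_iff]
  intro z hz
  have h2 : 0 < (2 * z).im := by simpa using hz
  have h : DifferentiableAt ℂ (fun z : ℂ ↦ η (2 * z) ^ 8 / η z ^ 4) z :=
    .div (.fun_pow (DifferentiableAt.comp z (differentiableAt_eta_of_mem_upperHalfPlaneSet h2)
      (by fun_prop)) 8) (.fun_pow (differentiableAt_eta_of_mem_upperHalfPlaneSet hz) 4)
      (pow_ne_zero _ (eta_ne_zero hz))
  refine h.differentiableWithinAt.congr (fun w hw ↦ ?_) ?_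
  · simp [etaQuotient, ofComplex_apply_of_im_pos hw]
  · simp [etaQuotient, ofComplex_apply_of_im_pos hz]
end EtaQuotient

lemma qParam_one_natCast_mul (n : ℕ) (z : ℂ) :
    Function.Periodic.qParam 1 (n * z) = Function.Periodic.qParam 1 z ^ n := by
  rw [Function.Periodic.qParam, Function.Periodic.qParam, ← Complex.exp_nat_mul]
  congr 1
  ring

lemma tendsto_euler_qParam {h : ℝ} (hh : 0 < h) :
    Tendsto (fun τ : ℍ ↦ euler (Function.Periodic.qParam h τ)) atImInfty (𝓝 1) :=
  tendsto_euler (qParam_tendsto_atImInfty hh)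

lemma isBoundedAtImInfty_of_tendsto {f : ℍ → ℂ} {c : ℂ} (h : Tendsto f atImInfty (𝓝 c)) :
    IsBoundedAtImInfty f :=
  h.isBigO_one ℝ

section EtaQuotientModular

open ModularGroup

lemma etaQuotient_eq (τ : ℍ) : etaQuotient τ = Function.Periodic.qParam 2 τ *
    (euler (Function.Periodic.qParam 1 τ ^ 2) ^ 8 / euler (Function.Periodic.qParam 1 τ) ^ 4) := by
  have h : Function.Periodic.qParam 24 (2 * τ) ^ 8 =
      Function.Periodic.qParam 2 τ * Function.Periodic.qParam 24 τ ^ 4 := by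
    simp only [Function.Periodic.qParam, ← Complex.exp_nat_mul, ← Complex.exp_add]
    congr 1
    push_cast
    ring
  have h0 : Function.Periodic.qParam 24 (τ : ℂ) ≠ 0 := Function.Periodic.qParam_ne_zero _
  rw [etaQuotient, eta_eq_mul_euler, eta_eq_mul_euler, mul_pow, mul_pow, h,
    ← qParam_one_natCast_mul, mul_right_comm, mul_comm (_ ^ 4) (euler _ ^ 4), Nat.cast_ofNat,
    mul_div_mul_right _ _ (pow_ne_zero 4 h0), mul_div_assoc]

lemma isBoundedAtImInfty_etaQuotient : IsBoundedAtImInfty etaQuotient := by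
  have h := qParam_tendsto_atImInfty one_pos
  have h2 : Tendsto (fun τ : ℍ ↦ Function.Periodic.qParam 1 τ ^ 2) atImInfty (𝓝 0) := by
    simpa using h.pow 2
  refine isBoundedAtImInfty_of_tendsto (c := 0 * (1 ^ 8 / 1 ^ 4)) (Tendsto.congr
    (fun τ ↦ (etaQuotient_eq τ).symm) ?_)
  exact (qParam_tendsto_atImInfty two_pos).mul
    (((tendsto_euler h2).pow 8).div ((tendsto_euler h).pow 4) (by norm_num))

lemma isBoundedAtImInfty_etaQuotient_slash_S :
    IsBoundedAtImInfty (etaQuotient ∣[(2 : ℤ)] S) := by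
  refine isBoundedAtImInfty_of_tendsto (c := -(1 / 16) * (1 ^ 8 / 1 ^ 4)) (Tendsto.congr
    (fun τ ↦ (etaQuotient_slash_S τ).symm) ?_)
  refine Tendsto.congr (fun τ ↦ ?_) (((((tendsto_euler_qParam two_pos).pow 8).div
    ((tendsto_euler_qParam one_pos).pow 4) (by norm_num))).const_mul (-(1 / 16)))
  have h : Function.Periodic.qParam 24 (τ / 2) ^ 8 = Function.Periodic.qParam 24 τ ^ 4 := by
    simp only [Function.Periodic.qParam, ← Complex.exp_nat_mul]
    congr 1
    push_cast
    ring
  have h' : Function.Periodic.qParam 1 (τ / 2) = Function.Periodic.qParam 2 τ := by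
    simp only [Function.Periodic.qParam]
    congr 1
    push_cast
    ring
  have h0 : Function.Periodic.qParam 24 (τ : ℂ) ≠ 0 := Function.Periodic.qParam_ne_zero _
  rw [eta_eq_mul_euler, eta_eq_mul_euler, mul_pow, mul_pow, h, h',
    mul_div_mul_left _ _ (pow_ne_zero 4 h0)]
  simp

lemma etaQuotient_isModular : IsModular (Gamma0 2) 2 (fun γ ↦ (-1) ^ γ 0 1) etaQuotient where
  mdiff := etaQuotient_mdifferentiable
  slash_eq γ hγ := by
    rw [slash_eq_slashOrbit etaQuotient_slash_T etaQuotient_slash_S_mul_T_mul_T, slashOrbit,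
      if_pos]
    rw [Gamma0_mem, ZMod.intCast_eq_zero_iff_even] at hγ
    exact hγ
  bdd γ := by
    rw [slash_eq_slashOrbit etaQuotient_slash_T etaQuotient_slash_S_mul_T_mul_T, slashOrbit]
    split_ifs
    · exact isBoundedAtImInfty_etaQuotient.smul _
    · exact isBoundedAtImInfty_etaQuotient_slash_S.smul _
    · rw [SlashAction.slash_mul]
      exact (IsBoundedAtImInfty.slash 2 (g := mapGL ℝ T) (by simp [mapGL_coe_matrix, coe_T])
        isBoundedAtImInfty_etaQuotient_slash_S).smul _

end EtaQuotientModular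

section EtaQuotientDual

open ModularGroup

/-- The eta quotient `η(τ)⁸ / η(2τ)⁴`. -/
noncomputable def etaQuotientDual : ℍ → ℂ :=
  (-8 : ℂ) • ((etaQuotient ∣[(2 : ℤ)] S) ∣[(2 : ℤ)] scaling 2)

lemma etaQuotientDual_apply (τ : ℍ) : etaQuotientDual τ = η τ ^ 8 / η (2 * τ) ^ 4 := by
  rw [etaQuotientDual, Pi.smul_apply, slash_scaling_apply, etaQuotient_slash_S, coe_scaling_smul,
    smul_eq_mul, Nat.cast_ofNat, mul_div_cancel_left₀ _ two_ne_zero]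
  norm_num
  ring

lemma etaQuotientDual_isModular :
    IsModular (Gamma0 2) 2 (fun γ ↦ (-1) ^ (γ 1 0 / 2)) etaQuotientDual := by
  refine .smul _ ⟨(etaQuotient_isModular.mdiff.slash 2 _).slash 2 _, fun γ hγ ↦ ?_,
    isBoundedAtImInfty_slash_scaling fun γ ↦ ?_⟩
  · rw [Gamma0_mem, CharP.intCast_eq_zero_iff _ 2] at hγ
    obtain ⟨γ', h, -, h01, h10, -⟩ := exists_scaling_mul_eq (N := 2) (mod_cast hγ)
    have h' : S * γ' = (S * γ' * S⁻¹) * S := by group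
    have e : (S * γ' * S⁻¹).val = !![γ' 1 1, -γ' 1 0; -γ' 0 1, γ' 0 0] := by
      rw [Matrix.SpecialLinearGroup.coe_mul, Matrix.SpecialLinearGroup.coe_mul,
        Matrix.SpecialLinearGroup.coe_inv, coe_S, Matrix.adjugate_fin_two_of]
      ext i j
      fin_cases i <;> fin_cases j <;> simp [Matrix.mul_apply, Matrix.vecMul, dotProduct]
    have e01 : (S * γ' * S⁻¹) 0 1 = -γ' 1 0 := by simp [e]
    have e10 : (S * γ' * S⁻¹) 1 0 = -γ' 0 1 := by simp [e]
    have hmem : S * γ' * S⁻¹ ∈ Gamma0 2 := by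
      rw [Gamma0_mem, e10, h01, CharP.intCast_eq_zero_iff _ 2]
      simp
    rw [slash_scaling_slash _ h, ← SlashAction.slash_mul, h', SlashAction.slash_mul,
      etaQuotient_isModular.slash_eq _ hmem, e01, SL_smul_slash, smul_slash_scaling, h10]
    simp [← inv_zpow]
  · rw [← SlashAction.slash_mul]
    exact etaQuotient_isModular.bdd _

end EtaQuotientDual

section EisensteinTwo

open EisensteinSeries

lemma isBoundedAtImInfty_D2 (γ : SL(2, ℤ)) : IsBoundedAtImInfty (D2 γ) := by
  rw [isBoundedAtImInfty_iff]
  refine ⟨2 * Real.pi, 1, fun τ hτ ↦ ?_⟩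
  rw [D2, ModularGroup.denom_apply]
  rcases eq_or_ne (γ 1 0) 0 with h | h
  · simp [h, Real.pi_nonneg]
  have h1 : 0 < |(γ 1 0 : ℝ)| := by simpa using h
  have h2 : |(γ 1 0 : ℝ)| ≤ ‖(γ 1 0 * τ + γ 1 1 : ℂ)‖ := calc
    _ ≤ |(γ 1 0 : ℝ)| * τ.im := le_mul_of_one_le_right h1.le hτ
    _ = |(γ 1 0 * τ + γ 1 1 : ℂ).im| := by simp [abs_mul, abs_of_pos τ.im_pos]
    _ ≤ _ := Complex.abs_im_le_norm _
  rw [norm_div, div_le_iff₀ (h1.trans_le h2)]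
  simpa [abs_of_pos Real.pi_pos] using mul_le_mul_of_nonneg_left h2 Real.two_pi_pos.le

lemma D2_slash_scaling {N : ℕ} [NeZero N] {γ γ' : SL(2, ℤ)} (h10 : γ 1 0 = N * γ' 1 0)
    (h11 : γ' 1 1 = γ 1 1) : D2 γ' ∣[(2 : ℤ)] scaling N = D2 γ := by
  ext τ
  rw [slash_scaling_apply, D2, D2, ModularGroup.denom_apply, ModularGroup.denom_apply,
    coe_scaling_smul, h11, h10]
  norm_num
  ring

/-- The weight two Eisenstein series `N E₂(Nτ) - E₂(τ)` of level `N`. -/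
noncomputable def eisensteinTwo (N : ℕ) [NeZero N] : ℍ → ℂ := E2 ∣[(2 : ℤ)] scaling N - E2

lemma eisensteinTwo_isModular (N : ℕ) [NeZero N] :
    IsModular (Gamma0 N) 2 1 (eisensteinTwo N) where
  mdiff := (E2_mdifferentiable.slash 2 _).sub E2_mdifferentiable
  slash_eq γ hγ := by
    rw [Gamma0_mem, CharP.intCast_eq_zero_iff _ N] at hγ
    obtain ⟨γ', h, -, -, h10, h11⟩ := exists_scaling_mul_eq hγ
    rw [eisensteinTwo, sub_eq_add_neg, SlashAction.add_slash, SlashAction.neg_slash,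
      slash_scaling_slash _ h, E2_slash_action, E2_slash_action, sub_eq_add_neg,
      SlashAction.add_slash, SlashAction.neg_slash, smul_slash_scaling, D2_slash_scaling h10 h11]
    simp only [Pi.one_apply, one_smul]
    abel
  bdd γ := by
    have h (γ : SL(2, ℤ)) : IsBoundedAtImInfty (E2 ∣[(2 : ℤ)] γ) := by
      rw [E2_slash_action, sub_eq_add_neg, ← _root_.neg_smul]
      exact isBoundedAtImInfty_E2.add ((isBoundedAtImInfty_D2 γ).smul _)
    rw [eisensteinTwo, sub_eq_add_neg, SlashAction.add_slash, SlashAction.neg_slash]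
    exact (isBoundedAtImInfty_slash_scaling h γ).add (h γ).neg_left

end EisensteinTwo

lemma euler_sub_one_sub_isBigO {α : Type*} {l : Filter α} {x : α → ℂ} (hx : Tendsto x l (𝓝 0)) :
    (fun t ↦ euler (x t) - (1 - x t)) =O[l] fun t ↦ x t ^ 2 := by
  have h : (fun t ↦ x t ^ 2 * (x t - 1)) =O[l] fun t ↦ x t ^ 2 * 1 :=
    (isBigO_refl _ _).mul ((hx.sub_const 1).isBigO_one ℂ)
  simp only [mul_one] at h
  refine ((euler_sub_prod_isBigO hx 2).add h).congr_left fun t ↦ ?_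
  rw [Finset.prod_range_succ, Finset.prod_range_one]
  ring

section LevelTwoIdentity

open EisensteinSeries

lemma tendsto_scaling_smul_atImInfty (N : ℕ) [NeZero N] :
    Tendsto (fun τ : ℍ ↦ scaling N • τ) atImInfty atImInfty := by
  rw [atImInfty, tendsto_comap_iff]
  have h (τ : ℍ) : (UpperHalfPlane.im ∘ fun τ : ℍ ↦ scaling N • τ) τ = N * τ.im := by
    rw [Function.comp_apply, ← coe_im, coe_scaling_smul]
    simp
  exact (tendsto_comap.const_mul_atTop (Nat.cast_pos.mpr (Nat.pos_of_neZero N))).congr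
    fun τ ↦ (h τ).symm

lemma qParam_scaling_smul (N : ℕ) [NeZero N] (τ : ℍ) :
    Function.Periodic.qParam 1 (scaling N • τ : ℍ) = Function.Periodic.qParam 1 τ ^ N := by
  rw [coe_scaling_smul, qParam_one_natCast_mul]

lemma E2_isBigO : (fun τ : ℍ ↦ E2 τ - (1 - 24 * Function.Periodic.qParam 1 τ)) =O[atImInfty]
    fun τ : ℍ ↦ Function.Periodic.qParam 1 τ ^ 2 := by
  have h : IsBoundedAtImInfty fun τ : ℍ ↦
      (E2 τ - (1 - 24 * Function.Periodic.qParam 1 τ)) / Function.Periodic.qParam 1 τ ^ 2 := by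
    refine isBoundedAtImInfty_of_hasSum_qExpansion one_pos
      (c := fun m ↦ -24 * ArithmeticFunction.sigma 1 (m + 2)) fun τ ↦ ?_
    have h1 := hasSum_qExpansion_E2 (z := τ)
    have hq : Complex.exp (2 * Real.pi * Complex.I * τ) = Function.Periodic.qParam 1 τ := by
      simp [Function.Periodic.qParam]
    have h0 : Function.Periodic.qParam 1 (τ : ℂ) ≠ 0 := Function.Periodic.qParam_ne_zero _
    simp only [hq] at h1
    rw [← hasSum_nat_add_iff' 2] at h1
    convert h1.div_const (Function.Periodic.qParam 1 τ ^ 2) using 2 with m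
    · rfl
    · simp only [pow_add, Nat.add_eq_zero_iff, smul_eq_mul, OfNat.ofNat_ne_zero,
        and_false, if_false]
      field_simp
    · simp [Finset.sum_range_succ]
      ring
  have h2 := (IsBigO.trans h (isBigO_const_const (1 : ℝ) (one_ne_zero (α := ℂ)) _)).mul
    (isBigO_refl (fun τ : ℍ ↦ Function.Periodic.qParam 1 τ ^ 2) atImInfty)
  refine h2.congr (fun τ ↦ ?_) fun τ ↦ ?_
  · exact div_mul_cancel₀ _ (pow_ne_zero 2 (Function.Periodic.qParam_ne_zero _))
  · simp

lemma eisensteinTwo_two_isBigO :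
    (fun τ : ℍ ↦ eisensteinTwo 2 τ - (1 + 24 * Function.Periodic.qParam 1 τ)) =O[atImInfty]
      fun τ : ℍ ↦ Function.Periodic.qParam 1 τ ^ 2 := by
  have h : (fun τ : ℍ ↦ E2 (scaling 2 • τ) - (1 - 24 * Function.Periodic.qParam 1 τ ^ 2))
      =O[atImInfty]
      fun τ : ℍ ↦ Function.Periodic.qParam 1 τ ^ 2 := by
    have h1 := E2_isBigO.comp_tendsto (tendsto_scaling_smul_atImInfty 2)
    simp only [Function.comp_def, qParam_scaling_smul] at h1
    exact h1.trans (pow_pow_isBigO (qParam_tendsto_atImInfty one_pos) two_ne_zero 2)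
  refine (((h.const_mul_left 2).sub E2_isBigO).sub ((isBigO_refl _ _).const_mul_left 48)).congr_left
    fun τ ↦ ?_
  simp only [eisensteinTwo, Pi.sub_apply, slash_scaling_apply]
  norm_num
  ring

lemma tendsto_eisensteinTwo_two : Tendsto (eisensteinTwo 2) atImInfty (𝓝 1) := by
  have hx := qParam_tendsto_atImInfty one_pos
  have h := eisensteinTwo_two_isBigO.trans_tendsto (by simpa using hx.pow 2)
  have h2 : Tendsto (fun τ : ℍ ↦ 1 + 24 * Function.Periodic.qParam 1 τ) atImInfty (𝓝 1) := by
    simpa using (hx.const_mul 24).const_add 1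
  simpa using h.add h2

lemma etaQuotientDual_eq (τ : ℍ) : etaQuotientDual τ =
    euler (Function.Periodic.qParam 1 τ) ^ 8 / euler (Function.Periodic.qParam 1 τ ^ 2) ^ 4 := by
  have h : Function.Periodic.qParam 24 (2 * τ) ^ 4 = Function.Periodic.qParam 24 τ ^ 8 := by
    simp only [Function.Periodic.qParam, ← Complex.exp_nat_mul]
    congr 1
    push_cast
    ring
  have h0 : Function.Periodic.qParam 24 (τ : ℂ) ≠ 0 := Function.Periodic.qParam_ne_zero _
  rw [etaQuotientDual_apply, eta_eq_mul_euler, eta_eq_mul_euler, mul_pow, mul_pow, h,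
    ← qParam_one_natCast_mul, Nat.cast_ofNat, mul_div_mul_left _ _ (pow_ne_zero 8 h0)]

lemma etaQuotient_sq_eq (τ : ℍ) : etaQuotient τ ^ 2 = Function.Periodic.qParam 1 τ *
    (euler (Function.Periodic.qParam 1 τ ^ 2) ^ 16 / euler (Function.Periodic.qParam 1 τ) ^ 8) := by
  have h : Function.Periodic.qParam 2 (τ : ℂ) ^ 2 = Function.Periodic.qParam 1 τ := by
    simp only [Function.Periodic.qParam, ← Complex.exp_nat_mul]
    congr 1
    push_cast
    ring
  rw [etaQuotient_eq, mul_pow, h, div_pow, ← pow_mul, ← pow_mul]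

lemma euler_qParam_ne_zero (τ : ℍ) : euler (Function.Periodic.qParam 1 τ) ≠ 0 := by
  have h := eta_ne_zero τ.2
  rw [eta_eq_mul_euler] at h
  exact right_ne_zero_of_mul h

lemma euler_qParam_pow_ne_zero (N : ℕ) [NeZero N] (τ : ℍ) :
    euler (Function.Periodic.qParam 1 τ ^ N) ≠ 0 := by
  rw [← qParam_scaling_smul]
  exact euler_qParam_ne_zero _

lemma eisensteinTwo_two_euler_isBigO : (fun τ : ℍ ↦
      eisensteinTwo 2 τ ^ 2 * (euler (Function.Periodic.qParam 1 τ) ^ 8 *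
        euler (Function.Periodic.qParam 1 τ ^ 2) ^ 8) -
      (euler (Function.Periodic.qParam 1 τ) ^ 24 + 64 * Function.Periodic.qParam 1 τ *
        euler (Function.Periodic.qParam 1 τ ^ 2) ^ 24)) =O[atImInfty]
      fun τ : ℍ ↦ Function.Periodic.qParam 1 τ ^ 2 := by
  have hx := qParam_tendsto_atImInfty one_pos
  have hx2 : Tendsto (fun τ : ℍ ↦ Function.Periodic.qParam 1 τ ^ 2) atImInfty (𝓝 0) := by
    simpa using hx.pow 2
  have ev := Approx.var (l := atImInfty) (x := fun τ : ℍ ↦ Function.Periodic.qParam 1 τ)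
    (K := 36) (N := 2)
  have ec := ((Approx.const 1).add ((Approx.const 24).mul hx ev)).of_isBigO
    (g := eisensteinTwo 2) (eisensteinTwo_two_isBigO.congr_left fun τ ↦ by simp)
  have e1 := ((Approx.const 1).add ((Approx.const (-1)).mul hx ev)).of_isBigO
    (g := fun τ : ℍ ↦ euler (Function.Periodic.qParam 1 τ))
    ((euler_sub_one_sub_isBigO hx).congr_left fun τ ↦ by simp [sub_eq_add_neg])
  have e2 := (Approx.const (K := 36) 1).of_isBigO
    (g := fun τ : ℍ ↦ euler (Function.Periodic.qParam 1 τ ^ 2))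
    ((((euler_sub_prod_isBigO hx2 1).congr_right fun τ ↦ pow_one _).sub
      (isBigO_refl _ _)).congr_left fun τ ↦ by simp; ring)
  have h := ((ec.pow hx 2).mul hx ((e1.pow hx 8).mul hx (e2.pow hx 8))).add
    ((Approx.const (-1)).mul hx ((e1.pow hx 24).add
      (((Approx.const 64).mul hx ev).mul hx (e2.pow hx 24))))
  refine ((h.congr_residue ?_).isBigO hx (by norm_num)).congr_left fun τ ↦ ?_
  · push_cast
    decide +kernel
  · push_cast
    ring

lemma isBigO_of_mul_of_tendsto_one {α : Type*} {l : Filter α} {f g h : α → ℂ}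
    (hg : Tendsto g l (𝓝 1)) (hfg : (fun t ↦ f t * g t) =O[l] h) : f =O[l] h := by
  have h1 := hfg.mul ((hg.inv₀ one_ne_zero).isBigO_one ℂ)
  simp only [mul_one] at h1
  refine h1.congr' ?_ .rfl
  filter_upwards [hg.eventually_ne one_ne_zero] with t ht
  rw [mul_inv_cancel_right₀ ht]

lemma tendsto_euler_qParam_pow {N : ℕ} (hN : N ≠ 0) :
    Tendsto (fun τ : ℍ ↦ euler (Function.Periodic.qParam 1 τ ^ N)) atImInfty (𝓝 1) :=
  tendsto_euler (by simpa [hN] using (qParam_tendsto_atImInfty one_pos).pow N)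

lemma neg_one_zpow_mul_self (n : ℤ) : (-1 : ℂ) ^ n * (-1) ^ n = 1 := by
  rw [← mul_zpow]
  simp

theorem eisensteinTwo_two_sq (τ : ℍ) :
    eisensteinTwo 2 τ ^ 2 = etaQuotientDual τ ^ 2 + 64 * etaQuotient τ ^ 2 := by
  have hc : IsModular (Gamma0 2) 4 1 (eisensteinTwo 2 * eisensteinTwo 2) :=
    ((eisensteinTwo_isModular 2).mul (eisensteinTwo_isModular 2)).congr le_rfl (by simp)
  have hb : IsModular (Gamma0 2) 4 1 (etaQuotientDual * etaQuotientDual) :=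
    (etaQuotientDual_isModular.mul etaQuotientDual_isModular).congr le_rfl
      fun γ _ ↦ neg_one_zpow_mul_self _
  have ha : IsModular (Gamma0 2) 4 1 (etaQuotient * etaQuotient) :=
    (etaQuotient_isModular.mul etaQuotient_isModular).congr le_rfl
      fun γ _ ↦ neg_one_zpow_mul_self _
  have h := hc.add ((hb.smul (-1)).add (ha.smul (-64)))
  have : Fact (Nat.Prime 2) := ⟨Nat.prime_two⟩
  have h0 := eq_zero_of_isBigO (Gamma0 2) h.mdiff
    (fun γ hγ ↦ (h.slash_eq γ hγ).trans (one_smul _ _)) h.bdd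
    (N := 2) (by have := index_Gamma0_le 2; lia) ?_
  · have := congrFun h0 τ
    simp only [Pi.add_apply, Pi.mul_apply, Pi.smul_apply, smul_eq_mul, Pi.zero_apply] at this
    linear_combination this
  · refine isBigO_of_mul_of_tendsto_one (l := atImInfty)
      (g := fun τ ↦ euler (Function.Periodic.qParam 1 τ) ^ 8 *
      euler (Function.Periodic.qParam 1 τ ^ 2) ^ 8) ?_ ?_
    · simpa using ((tendsto_euler_qParam one_pos).pow 8).mul
        ((tendsto_euler_qParam_pow two_ne_zero).pow 8)
    · refine eisensteinTwo_two_euler_isBigO.congr_left fun τ ↦ ?_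
      have h1 := euler_qParam_ne_zero τ
      have h2 := euler_qParam_pow_ne_zero 2 τ
      simp only [Pi.add_apply, Pi.smul_apply, smul_eq_mul, ← pow_two, Pi.pow_apply,
        etaQuotient_sq_eq, etaQuotientDual_eq]
      field_simp
      ring

lemma eisensteinTwo_two_sq_mul_euler (τ : ℍ) :
    eisensteinTwo 2 τ ^ 2 * euler (Function.Periodic.qParam 1 τ) ^ 8 *
        euler (Function.Periodic.qParam 1 τ ^ 2) ^ 8 =
      euler (Function.Periodic.qParam 1 τ) ^ 24 + 64 * Function.Periodic.qParam 1 τ *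
        euler (Function.Periodic.qParam 1 τ ^ 2) ^ 24 := by
  have h1 := euler_qParam_ne_zero τ
  have h2 := euler_qParam_pow_ne_zero 2 τ
  rw [eisensteinTwo_two_sq, etaQuotient_sq_eq, etaQuotientDual_eq]
  field_simp

end LevelTwoIdentity

section Homogeneous

/-- `L` is a triangular array of coefficients with `n` rows, of lengths `n`, …, `1`. -/
inductive IsTriangular : ℕ → List (List ℤ) → Prop
  | nil : IsTriangular 0 []
  | cons {n : ℕ} {r : List ℤ} {L : List (List ℤ)} (hr : r.length = n + 1)
      (hL : IsTriangular n L) : IsTriangular (n + 1) (r :: L)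

lemma isTriangular_modularRows : IsTriangular 16 modularRows := by
  unfold modularRows
  repeat' constructor

variable {R S : Type*} [CommRing R] [CommRing S]

lemma map_rowEval (φ : R →+* S) (L : List ℤ) (y z : R) :
    φ (rowEval Int.cast y z L).1 = (rowEval Int.cast (φ y) (φ z) L).1 ∧
      φ (rowEval Int.cast y z L).2 = (rowEval Int.cast (φ y) (φ z) L).2 := by
  induction L with
  | nil => simp [rowEval]
  | cons p L ih =>
    simp only [rowEval, List.foldr_cons, map_add, map_mul, map_intCast] at ih ⊢
    rw [ih.1, ih.2]
    exact ⟨rfl, rfl⟩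

lemma map_formEval (φ : R →+* S) (L : List (List ℤ)) (x y z : R) :
    φ (formEval Int.cast L x y z) = formEval Int.cast L (φ x) (φ y) (φ z) := by
  induction L with
  | nil => simp [formEval]
  | cons r L ih =>
    simp only [formEval, List.foldr_cons, map_add, map_mul, (map_rowEval φ r y z).1] at ih ⊢
    rw [ih]

lemma rowEval_mem_graded {M : ℕ → R → Prop} (hc : ∀ p : ℤ, M 0 p)
    (hadd : ∀ n f g, M n f → M n g → M n (f + g))
    (hmul : ∀ m n f g, M m f → M n g → M (m + n) (f * g))
    {y z : R} (hy : M 1 y) (hz : M 1 z) (L : List ℤ) :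
    (∀ n, L.length = n + 1 → M n (rowEval Int.cast y z L).1) ∧
      M L.length (rowEval Int.cast y z L).2 := by
  induction L with
  | nil => exact ⟨by simp, by simpa [rowEval] using hc 1⟩
  | cons p L ih =>
    refine ⟨fun n hn ↦ ?_, ?_⟩
    · obtain rfl : L.length = n := by simpa using hn
      have h1 := hmul _ _ _ _ (hc p) ih.2
      rw [zero_add] at h1
      cases L with
      | nil => simpa [rowEval] using hc p
      | cons t L =>
        have h2 := hmul _ _ _ _ hy (ih.1 _ rfl)
        rw [add_comm 1] at h2
        exact hadd _ _ _ h1 h2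
    · rw [List.length_cons, add_comm]
      exact hmul _ _ _ _ hz ih.2

lemma formEval_mem_graded {M : ℕ → R → Prop} (hc : ∀ p : ℤ, M 0 p)
    (hadd : ∀ n f g, M n f → M n g → M n (f + g))
    (hmul : ∀ m n f g, M m f → M n g → M (m + n) (f * g))
    {x y z : R} (hx : M 1 x) (hy : M 1 y) (hz : M 1 z) {L : List (List ℤ)} {n : ℕ}
    (hL : IsTriangular (n + 1) L) :
    M n (formEval Int.cast L x y z) := by
  induction n generalizing L with
  | zero =>
    obtain _ | ⟨hr, hL⟩ := hL
    cases hL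
    simpa [formEval] using (rowEval_mem_graded hc hadd hmul hy hz _).1 0 hr
  | succ n ih =>
    obtain _ | ⟨hr, hL⟩ := hL
    have h := hmul _ _ _ _ hx (ih hL)
    rw [add_comm 1] at h
    exact hadd _ _ _ ((rowEval_mem_graded hc hadd hmul hy hz _).1 _ hr) h

lemma formEval_mul {L : List (List ℤ)} {n : ℕ} (hL : IsTriangular (n + 1) L) (s x y z : R) :
    formEval Int.cast L (s * x) (s * y) (s * z) = s ^ n * formEval Int.cast L x y z := by
  have h := formEval_mem_graded (R := R × R) (M := fun n p ↦ p.2 = s ^ n * p.1) (x := (x, s * x))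
    (y := (y, s * y)) (z := (z, s * z)) (by simp) (fun n f g hf hg ↦ by simp [hf, hg, mul_add])
    (fun m n f g hf hg ↦ by simp [hf, hg]; ring) (by simp) (by simp) (by simp) hL
  have h1 := map_formEval (RingHom.fst R R) L (x, s * x) (y, s * y) (z, s * z)
  have h2 := map_formEval (RingHom.snd R R) L (x, s * x) (y, s * y) (z, s * z)
  simp only [RingHom.coe_fst, RingHom.coe_snd] at h1 h2
  rw [← h2, h, h1]

end Homogeneous

lemma IsModular.formEval {Γ : Subgroup SL(2, ℤ)} {k : ℤ} {f g h : ℍ → ℂ} (hf : IsModular Γ k 1 f)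
    (hg : IsModular Γ k 1 g) (hh : IsModular Γ k 1 h) {L : List (List ℤ)} {n : ℕ}
    (hL : IsTriangular (n + 1) L) : IsModular Γ (k * n) 1 (formEval Int.cast L f g h) := by
  refine formEval_mem_graded (M := fun n f ↦ IsModular Γ (k * n) 1 f) (fun p ↦ ?_)
    (fun n f g hf hg ↦ hf.add hg) (fun m n f g hf hg ↦ ?_) (by simpa using hf) (by simpa using hg)
    (by simpa using hh) hL
  · have h := IsModular.const (Γ := Γ) (p : ℂ)
    simp only [Nat.cast_zero, mul_zero]
    exact h
  · have := hf.mul hg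
    rwa [one_mul, ← mul_add, ← Nat.cast_add] at this

lemma Gamma0_le_of_dvd {M N : ℕ} (h : M ∣ N) : Gamma0 N ≤ Gamma0 M := by
  intro γ hγ
  rw [Gamma0_mem, CharP.intCast_eq_zero_iff _ N] at hγ
  rw [Gamma0_mem, CharP.intCast_eq_zero_iff _ M]
  exact (Int.natCast_dvd_natCast.mpr h).trans hγ

section LevelFiftyEight

lemma etaQuotient_mul_isModular :
    IsModular (Gamma0 (2 * 29)) 4 1 (etaQuotient * (etaQuotient ∣[(2 : ℤ)] scaling 29)) := by
  have h := etaQuotient_isModular.slash_scaling (N := 29)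
    (χ' := fun γ ↦ (-1) ^ (29 * γ 0 1)) fun γ γ' h _ ↦ by simp [h]
  refine ((etaQuotient_isModular.congr (Gamma0_le_of_dvd (dvd_mul_right 2 29))
    fun _ _ ↦ rfl).mul h).congr le_rfl fun γ _ ↦ ?_
  rw [Pi.mul_apply, ← zpow_add₀ (by simp), show γ 0 1 + 29 * γ 0 1 = 2 * (15 * γ 0 1) by ring,
    zpow_mul]
  simp

lemma etaQuotientDual_mul_isModular : IsModular (Gamma0 (2 * 29)) 4 1
    (etaQuotientDual * (etaQuotientDual ∣[(2 : ℤ)] scaling 29)) := by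
  have h := etaQuotientDual_isModular.slash_scaling (N := 29)
    (χ' := fun γ ↦ (-1) ^ (γ 1 0 / 29 / 2)) fun γ γ' _ h ↦ by simp [h]
  refine ((etaQuotientDual_isModular.congr (Gamma0_le_of_dvd (dvd_mul_right 2 29))
    fun _ _ ↦ rfl).mul h).congr le_rfl fun γ hγ ↦ ?_
  rw [Gamma0_mem, CharP.intCast_eq_zero_iff _ (2 * 29)] at hγ
  obtain ⟨m, hm⟩ := hγ
  rw [Pi.mul_apply, ← zpow_add₀ (by simp), show γ 1 0 / 2 + γ 1 0 / 29 / 2 = 2 * (15 * m) by lia,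
    zpow_mul]
  simp

lemma eisensteinTwo_mul_isModular : IsModular (Gamma0 (2 * 29)) 4 1
    (eisensteinTwo 2 * (eisensteinTwo 2 ∣[(2 : ℤ)] scaling 29)) :=
  (((eisensteinTwo_isModular 2).congr (Gamma0_le_of_dvd (dvd_mul_right 2 29))
    fun _ _ ↦ rfl).mul ((eisensteinTwo_isModular 2).slash_scaling (N := 29) (χ' := 1)
      fun _ _ _ _ ↦ rfl)).congr le_rfl fun _ _ ↦ by simp

lemma qParam_two_mul_scaling_smul (τ : ℍ) : Function.Periodic.qParam 2 τ *
    Function.Periodic.qParam 2 (scaling 29 • τ : ℍ) = Function.Periodic.qParam 1 τ ^ 15 := by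
  rw [coe_scaling_smul]
  simp only [Function.Periodic.qParam, ← Complex.exp_nat_mul, ← Complex.exp_add]
  congr 1
  push_cast
  ring

theorem formEval_modularRows_eq_zero (τ : ℍ) : formEval Int.cast modularRows
    (64 * (etaQuotient τ * etaQuotient (scaling 29 • τ)))
    (etaQuotientDual τ * etaQuotientDual (scaling 29 • τ))
    (eisensteinTwo 2 τ * eisensteinTwo 2 (scaling 29 • τ)) = 0 := by
  have h := (etaQuotient_mul_isModular.smul 64).formEval etaQuotientDual_mul_isModular
    eisensteinTwo_mul_isModular isTriangular_modularRows
  have h2 : Fact (Nat.Prime 2) := ⟨Nat.prime_two⟩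
  have h29 : Fact (Nat.Prime 29) := ⟨by norm_num⟩
  have hF (τ : ℍ) := map_formEval (Pi.evalRingHom (fun _ : ℍ ↦ ℂ) τ) modularRows
    ((64 : ℂ) • (etaQuotient * (etaQuotient ∣[(2 : ℤ)] scaling 29)))
    (etaQuotientDual * (etaQuotientDual ∣[(2 : ℤ)] scaling 29))
    (eisensteinTwo 2 * (eisensteinTwo 2 ∣[(2 : ℤ)] scaling 29))
  have hF' (τ : ℍ) : formEval Int.cast modularRows
      ((64 : ℂ) • (etaQuotient * (etaQuotient ∣[(2 : ℤ)] scaling 29)))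
      (etaQuotientDual * (etaQuotientDual ∣[(2 : ℤ)] scaling 29))
      (eisensteinTwo 2 * (eisensteinTwo 2 ∣[(2 : ℤ)] scaling 29)) τ =
      29 ^ 15 * formEval Int.cast modularRows
        (64 * (etaQuotient τ * etaQuotient (scaling 29 • τ)))
        (etaQuotientDual τ * etaQuotientDual (scaling 29 • τ))
        (eisensteinTwo 2 τ * eisensteinTwo 2 (scaling 29 • τ)) := by
    rw [← formEval_mul isTriangular_modularRows]
    have h1 := hF τ
    rw [Pi.evalRingHom_apply] at h1
    rw [h1]
    congr 1 <;> simp [slash_scaling_apply] <;> ring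
  have h0 := eq_zero_of_isBigO (Gamma0 (2 * 29)) h.mdiff
    (fun γ hγ ↦ (h.slash_eq γ hγ).trans (one_smul _ _)) h.bdd (N := 451)
    (by have := index_Gamma0_mul_le 2 29 (by norm_num); lia) ?_
  · have h1 := hF' τ
    rw [h0] at h1
    simpa using h1.symm
  · have hx := qParam_tendsto_atImInfty one_pos
    have hE : Tendsto (fun τ : ℍ ↦ (euler (Function.Periodic.qParam 1 τ) *
        euler (Function.Periodic.qParam 1 τ ^ 29) * (euler (Function.Periodic.qParam 1 τ ^ 2) *
          euler (Function.Periodic.qParam 1 τ ^ 58))) ^ 4) atImInfty (𝓝 1) := by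
      simpa using (((tendsto_euler_qParam one_pos).mul
        (tendsto_euler_qParam_pow (N := 29) (by norm_num))).mul
        ((tendsto_euler_qParam_pow two_ne_zero).mul
        (tendsto_euler_qParam_pow (N := 58) (by norm_num)))).pow 4
    have hform := form_isBigO hx tendsto_eisensteinTwo_two
      (tendsto_eisensteinTwo_two.comp (tendsto_scaling_smul_atImInfty 29))
      eisensteinTwo_two_sq_mul_euler fun τ ↦ by
        have := eisensteinTwo_two_sq_mul_euler (scaling 29 • τ)
        rwa [qParam_scaling_smul, ← pow_mul] at this
    refine isBigO_of_mul_of_tendsto_one (l := atImInfty) (by simpa using hE.pow 15)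
      ((hform.const_mul_left (29 ^ 15)).congr_left fun τ ↦ ?_)
    have h1 := euler_qParam_ne_zero τ
    have h2 := euler_qParam_pow_ne_zero 2 τ
    have h3 := euler_qParam_pow_ne_zero 29 τ
    have h4 := euler_qParam_pow_ne_zero 58 τ
    rw [hF', mul_assoc (29 ^ 15), mul_comm (formEval _ _ _ _ _) (_ ^ 15),
      ← formEval_mul isTriangular_modularRows (_ ^ 4)]
    congr 2
    · rw [etaQuotient_eq, etaQuotient_eq, qParam_scaling_smul, ← pow_mul,
        ← qParam_two_mul_scaling_smul]
      field_simp
    · rw [etaQuotientDual_eq, etaQuotientDual_eq, qParam_scaling_smul, ← pow_mul]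
      field_simp
    · rw [mul_comm]
      rfl

end LevelFiftyEight

section RealProducts

variable {q : ℝ}

/-- The real infinite product `∏ (1 - qⁿ)`. -/
noncomputable def realEuler (q : ℝ) : ℝ := ∏' n : ℕ, (1 - q ^ (n + 1))

lemma summable_pow_succ (hq0 : 0 < q) (hq1 : q < 1) : Summable fun n : ℕ ↦ q ^ (n + 1) :=
  (summable_nat_add_iff 1).mpr (summable_geometric_of_lt_one hq0.le hq1)

lemma multipliable_one_sub_real (hq0 : 0 < q) (hq1 : q < 1) :
    Multipliable fun n : ℕ ↦ 1 - q ^ (n + 1) := by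
  simpa only [sub_eq_add_neg] using
    Real.multipliable_one_add_of_summable (summable_pow_succ hq0 hq1).neg

lemma realEuler_pos (hq0 : 0 < q) (hq1 : q < 1) : 0 < realEuler q := by
  rw [realEuler, ← Real.rexp_tsum_eq_tprod]
  · exact Real.exp_pos _
  · exact fun n ↦ sub_pos.mpr (pow_lt_one₀ hq0.le hq1 n.succ_ne_zero)
  · simpa only [sub_eq_add_neg] using
      Real.summable_log_one_add_of_summable (summable_pow_succ hq0 hq1).neg

lemma euler_ofReal (hq0 : 0 < q) (hq1 : q < 1) : euler q = realEuler q := by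
  have h := (multipliable_one_sub_real hq0 hq1).hasProd.map Complex.ofRealHom
    Complex.continuous_ofReal
  simpa [euler, realEuler, Function.comp_def] using h.tprod_eq

lemma tprod_one_add_pow_zpow (hq0 : 0 < q) (hq1 : q < 1) :
    ∏' n : ℕ, (1 + q ^ (n + 1)) ^ (-24 : ℤ) = realEuler q ^ 24 / realEuler (q ^ 2) ^ 24 := by
  have hq0' : 0 < q ^ 2 := by positivity
  have hq1' : q ^ 2 < 1 := pow_lt_one₀ hq0.le hq1 two_ne_zero
  have h := ((multipliable_one_sub_real hq0 hq1).hasProd.pow 24).div₀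
    ((multipliable_one_sub_real hq0' hq1').hasProd.pow 24)
    (pow_ne_zero 24 (realEuler_pos hq0' hq1').ne')
  refine Eq.trans (tprod_congr fun n ↦ ?_) h.tprod_eq
  have h1 : 0 < 1 - q ^ (n + 1) := sub_pos.mpr (pow_lt_one₀ hq0.le hq1 n.succ_ne_zero)
  rw [← div_pow, ← pow_mul, mul_comm 2, pow_mul,
    show 1 - (q ^ (n + 1)) ^ 2 = (1 - q ^ (n + 1)) * (1 + q ^ (n + 1)) by ring,
    div_mul_cancel_left₀ h1.ne', zpow_neg, inv_pow]
  norm_cast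

lemma x₂_eq (hq0 : 0 < q) (hq1 : q < 1) : x₂ q = 64 * q * realEuler (q ^ 2) ^ 24 /
    (realEuler q ^ 24 + 64 * q * realEuler (q ^ 2) ^ 24) := by
  have h := realEuler_pos (q := q ^ 2) (by positivity) (pow_lt_one₀ hq0.le hq1 two_ne_zero)
  have h1 := realEuler_pos hq0 hq1
  rw [x₂, tprod_one_add_pow_zpow hq0 hq1]
  field_simp
  ring

end RealProducts

section ImaginaryAxis

lemma qParam_one_of_re_eq_zero {τ : ℍ} (hτ : τ.re = 0) :
    Function.Periodic.qParam 1 τ = (Real.exp (-2 * Real.pi * τ.im) : ℝ) := by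
  have h : (τ : ℂ) = τ.im * Complex.I := by
    apply Complex.ext <;> simp [hτ]
  rw [Function.Periodic.qParam, h]
  push_cast
  congr 1
  rw [div_one, show 2 * (Real.pi : ℂ) * Complex.I * (τ.im * Complex.I) =
    2 * Real.pi * τ.im * (Complex.I * Complex.I) by ring, Complex.I_mul_I]
  ring

lemma eisensteinTwo_two_sq_eq {τ : ℍ} {q : ℝ} (hq0 : 0 < q) (hq1 : q < 1)
    (hτ : Function.Periodic.qParam 1 τ = q) : eisensteinTwo 2 τ ^ 2 =
      ((realEuler q ^ 24 + 64 * q * realEuler (q ^ 2) ^ 24) /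
        (realEuler q ^ 8 * realEuler (q ^ 2) ^ 8) : ℝ) := by
  have hq0' : 0 < q ^ 2 := by positivity
  have hq1' : q ^ 2 < 1 := pow_lt_one₀ hq0.le hq1 two_ne_zero
  have h := eisensteinTwo_two_sq_mul_euler τ
  have h1 := Complex.ofReal_ne_zero.mpr (realEuler_pos hq0 hq1).ne'
  have h2 := Complex.ofReal_ne_zero.mpr (realEuler_pos hq0' hq1').ne'
  rw [hτ, ← Complex.ofReal_pow q 2, euler_ofReal hq0 hq1, euler_ofReal hq0' hq1'] at h
  push_cast
  rw [eq_div_iff (by positivity), ← h]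
  ring

lemma eisensteinTwo_two_re_ne_zero {τ : ℍ} (hτ : τ.re = 0) :
    (eisensteinTwo 2 τ).re ≠ 0 ∧ (eisensteinTwo 2 τ).im = 0 := by
  have hq1 : Real.exp (-2 * Real.pi * τ.im) < 1 := by
    have := mul_pos Real.pi_pos τ.im_pos
    rw [Real.exp_lt_one_iff]
    linarith
  have h := eisensteinTwo_two_sq_eq (Real.exp_pos _) hq1 (qParam_one_of_re_eq_zero hτ)
  have h1 := realEuler_pos (Real.exp_pos _) hq1
  have h2 := realEuler_pos (q := Real.exp (-2 * Real.pi * τ.im) ^ 2) (by positivity)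
    (pow_lt_one₀ (Real.exp_pos _).le hq1 two_ne_zero)
  have hre := congrArg Complex.re h
  have him := congrArg Complex.im h
  rw [Complex.ofReal_re, sq, Complex.mul_re] at hre
  rw [Complex.ofReal_im, sq, Complex.mul_im] at him
  have h0 : (eisensteinTwo 2 τ).re ≠ 0 := by
    intro h0
    rw [h0] at hre
    have : 0 < (0 * 0 - (eisensteinTwo 2 τ).im * (eisensteinTwo 2 τ).im : ℝ) := by
      rw [hre]
      positivity
    nlinarith
  refine ⟨h0, ?_⟩
  rw [mul_comm (eisensteinTwo 2 τ).im, ← two_mul] at him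
  simpa [h0] using him

theorem eisensteinTwo_two_re_pos {τ : ℍ} (hτ : τ.re = 0) : 0 < (eisensteinTwo 2 τ).re := by
  let ι : Set.Ioi (0 : ℝ) → ℍ := fun t ↦ ⟨⟨0, t⟩, t.2⟩
  have hι : Continuous ι := by
    rw [UpperHalfPlane.isEmbedding_coe.continuous_iff]
    have : Continuous fun t : Set.Ioi (0 : ℝ) ↦ ((t : ℝ) : ℂ) * Complex.I := by fun_prop
    refine this.congr fun t ↦ ?_
    apply Complex.ext <;> simp [ι]
  have hc : Continuous fun t ↦ (eisensteinTwo 2 (ι t)).re :=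
    Complex.continuous_re.comp ((eisensteinTwo_isModular 2).mdiff.continuous.comp hι)
  by_contra! h
  have h1 : ∀ᶠ τ in atImInfty, 0 < (eisensteinTwo 2 τ).re :=
    ((Complex.continuous_re.tendsto _).comp tendsto_eisensteinTwo_two).eventually_const_lt
      (by simp)
  obtain ⟨A, hA⟩ := (atImInfty_mem _).mp h1
  have hι0 : ι ⟨τ.im, τ.im_pos⟩ = τ := by
    apply UpperHalfPlane.ext
    exact Complex.ext hτ.symm rfl
  have : PreconnectedSpace (Set.Ioi (0 : ℝ)) := Subtype.preconnectedSpace isPreconnected_Ioi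
  obtain ⟨t, ht⟩ := mem_range_of_exists_le_of_exists_ge hc ⟨⟨τ.im, τ.im_pos⟩, hι0.symm ▸ h⟩
    ⟨⟨max A 1, by simp⟩, (hA (ι ⟨max A 1, by simp⟩) (le_max_left A 1)).le⟩
  exact (eisensteinTwo_two_re_ne_zero (τ := ι t) rfl).1 ht

end ImaginaryAxis

section ModularEquation

lemma P_eq_formEval (u v : ℝ) : P u v = formEval Int.cast modularRows u v 1 := by
  simp only [P, formEval, modularRows, rowEval, List.foldr_cons, List.foldr_nil]
  push_cast
  ring

lemma x₂_eq_div_sq {q c : ℝ} (hq0 : 0 < q) (hq1 : q < 1)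
    (hc : c ^ 2 = (realEuler q ^ 24 + 64 * q * realEuler (q ^ 2) ^ 24) /
      (realEuler q ^ 8 * realEuler (q ^ 2) ^ 8)) :
    x₂ q = 64 * q * (realEuler (q ^ 2) ^ 8 / (realEuler q ^ 4 * c)) ^ 2 ∧
      1 - x₂ q = (realEuler q ^ 8 / (realEuler (q ^ 2) ^ 4 * c)) ^ 2 := by
  have h := realEuler_pos (q := q ^ 2) (by positivity) (pow_lt_one₀ hq0.le hq1 two_ne_zero)
  have h1 := realEuler_pos hq0 hq1
  rw [x₂_eq hq0 hq1, div_pow, div_pow, mul_pow, mul_pow, hc]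
  constructor
  · field_simp
  · field_simp
    ring

lemma sqrt_x₂_eq {q c c' : ℝ} (hq0 : 0 < q) (hq1 : q < 1) (hc0 : 0 < c) (hc0' : 0 < c')
    (hc : c ^ 2 = (realEuler q ^ 24 + 64 * q * realEuler (q ^ 2) ^ 24) /
      (realEuler q ^ 8 * realEuler (q ^ 2) ^ 8))
    (hc' : c' ^ 2 = (realEuler (q ^ 29) ^ 24 + 64 * q ^ 29 * realEuler ((q ^ 29) ^ 2) ^ 24) /
      (realEuler (q ^ 29) ^ 8 * realEuler ((q ^ 29) ^ 2) ^ 8)) :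
    √(x₂ (q ^ 29) * x₂ q) = (c * c')⁻¹ * (64 * (q ^ 15 *
      ((realEuler (q ^ 2) * realEuler ((q ^ 29) ^ 2)) ^ 8 /
        (realEuler q * realEuler (q ^ 29)) ^ 4))) ∧
    √((1 - x₂ (q ^ 29)) * (1 - x₂ q)) = (c * c')⁻¹ *
      ((realEuler q * realEuler (q ^ 29)) ^ 8 /
        (realEuler (q ^ 2) * realEuler ((q ^ 29) ^ 2)) ^ 4) := by
  have hq0' : 0 < q ^ 29 := by positivity
  have hq1' : q ^ 29 < 1 := pow_lt_one₀ hq0.le hq1 (by norm_num)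
  have h1 := realEuler_pos hq0 hq1
  have h2 := realEuler_pos (q := q ^ 2) (by positivity) (pow_lt_one₀ hq0.le hq1 two_ne_zero)
  have h3 := realEuler_pos hq0' hq1'
  have h4 := realEuler_pos (q := (q ^ 29) ^ 2) (by positivity)
    (pow_lt_one₀ hq0'.le hq1' two_ne_zero)
  obtain ⟨e1, e2⟩ := x₂_eq_div_sq hq0 hq1 hc
  obtain ⟨e3, e4⟩ := x₂_eq_div_sq hq0' hq1' hc'
  constructor
  · rw [← Real.sqrt_sq (x := _ * (64 * _)) (by positivity), e1, e3]
    congr 1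
    field_simp
  · rw [← Real.sqrt_sq (x := (c * c')⁻¹ * _) (by positivity), e2, e4]
    congr 1
    field_simp

lemma exists_qParam_one_eq {q : ℝ} (hq0 : 0 < q) (hq1 : q < 1) :
    ∃ τ : ℍ, τ.re = 0 ∧ Function.Periodic.qParam 1 τ = q := by
  have h : 0 < -Real.log q / (2 * Real.pi) :=
    div_pos (neg_pos.mpr (Real.log_neg hq0 hq1)) (by positivity)
  have h1 := qParam_one_of_re_eq_zero (τ := ⟨⟨0, _⟩, h⟩) rfl
  refine ⟨⟨⟨0, _⟩, h⟩, rfl, h1.trans ?_⟩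
  rw [UpperHalfPlane.mk_im]
  congr 1
  rw [show -2 * Real.pi * (-Real.log q / (2 * Real.pi)) = Real.log q by field_simp,
    Real.exp_log hq0]

lemma scaling_smul_re (N : ℕ) [NeZero N] {τ : ℍ} (hτ : τ.re = 0) : (scaling N • τ).re = 0 := by
  have h := congrArg Complex.re (coe_scaling_smul (N := N) τ)
  simpa [hτ] using h

end ModularEquation

/-- The modular equation of level 2 and degree 29: for `0 < q < 1`, with
`β = x₂(q)`, `α = x₂(q²⁹)`, `u = √(αβ)`, `v = √((1-α)(1-β))`, one has `P(u,v) = 0`. -/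
theorem modular_equation_level_two_degree_29 (q : ℝ) (hq0 : 0 < q) (hq1 : q < 1) :
    P (Real.sqrt (x₂ (q ^ 29) * x₂ q))
      (Real.sqrt ((1 - x₂ (q ^ 29)) * (1 - x₂ q))) = 0 := by
  obtain ⟨τ, hτ0, hτ⟩ := exists_qParam_one_eq hq0 hq1
  have hq0' : 0 < q ^ 29 := by positivity
  have hq1' : q ^ 29 < 1 := pow_lt_one₀ hq0.le hq1 (by norm_num)
  have hσ0 : (scaling 29 • τ).re = 0 := scaling_smul_re 29 hτ0
  have hσ : Function.Periodic.qParam 1 (scaling 29 • τ : ℍ) = (q ^ 29 : ℝ) := by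
    rw [qParam_scaling_smul, hτ, Complex.ofReal_pow]
  have hc (σ : ℍ) (hσ : σ.re = 0) : eisensteinTwo 2 σ = ((eisensteinTwo 2 σ).re : ℂ) :=
    Complex.ext rfl (eisensteinTwo_two_re_ne_zero hσ).2
  have hsq (σ : ℍ) (hσ : σ.re = 0) {r : ℝ} (h : eisensteinTwo 2 σ ^ 2 = r) :
      (eisensteinTwo 2 σ).re ^ 2 = r := by
    rw [hc σ hσ] at h
    exact_mod_cast h
  have hp := eisensteinTwo_two_re_pos hτ0
  have hp' := eisensteinTwo_two_re_pos hσ0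
  obtain ⟨hu, hv⟩ := sqrt_x₂_eq hq0 hq1 hp hp'
    (hsq τ hτ0 (eisensteinTwo_two_sq_eq hq0 hq1 hτ))
    (hsq _ hσ0 (eisensteinTwo_two_sq_eq hq0' hq1' hσ))
  have h := formEval_modularRows_eq_zero τ
  have he (x : ℝ) (h0 : 0 < x) (h1 : x < 1) : euler ((x : ℂ) ^ 2) = realEuler (x ^ 2) := by
    rw [← Complex.ofReal_pow, euler_ofReal (by positivity) (pow_lt_one₀ h0.le h1 two_ne_zero)]
  have hx : etaQuotient τ * etaQuotient (scaling 29 • τ) = (q ^ 15 *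
      ((realEuler (q ^ 2) * realEuler ((q ^ 29) ^ 2)) ^ 8 /
        (realEuler q * realEuler (q ^ 29)) ^ 4) : ℝ) := by
    rw [etaQuotient_eq, etaQuotient_eq, mul_mul_mul_comm, qParam_two_mul_scaling_smul, hσ, hτ,
      he q hq0 hq1, he _ hq0' hq1', euler_ofReal hq0 hq1, euler_ofReal hq0' hq1']
    push_cast
    rw [mul_pow, mul_pow, mul_div_mul_comm]
  have hy : etaQuotientDual τ * etaQuotientDual (scaling 29 • τ) =
      ((realEuler q * realEuler (q ^ 29)) ^ 8 /
        (realEuler (q ^ 2) * realEuler ((q ^ 29) ^ 2)) ^ 4 : ℝ) := by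
    rw [etaQuotientDual_eq, etaQuotientDual_eq, hσ, hτ,
      he q hq0 hq1, he _ hq0' hq1', euler_ofReal hq0 hq1, euler_ofReal hq0' hq1']
    push_cast
    rw [mul_pow, mul_pow, mul_div_mul_comm]
  rw [hx, hy, hc τ hτ0, hc _ hσ0] at h
  have h' := map_formEval Complex.ofRealHom modularRows (64 * (q ^ 15 *
      ((realEuler (q ^ 2) * realEuler ((q ^ 29) ^ 2)) ^ 8 /
        (realEuler q * realEuler (q ^ 29)) ^ 4)))
    ((realEuler q * realEuler (q ^ 29)) ^ 8 /
        (realEuler (q ^ 2) * realEuler ((q ^ 29) ^ 2)) ^ 4)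
    ((eisensteinTwo 2 τ).re * (eisensteinTwo 2 (scaling 29 • τ)).re)
  rw [map_mul Complex.ofRealHom 64, map_ofNat,
    map_mul Complex.ofRealHom (eisensteinTwo 2 τ).re] at h'
  have h0 := Complex.ofReal_eq_zero.mp (h'.trans h)
  rw [P_eq_formEval, hu, hv, ← inv_mul_cancel₀ (mul_pos hp hp').ne',
    formEval_mul isTriangular_modularRows, h0, mul_zero]
end

section
/- Let F(x) = \sum_{n=0}^{\infty} [ (1/4)_n (3/4)_n / (n!)^2 ] x^n for real 0 \le x < 1 (the hypergeometric function {}_2F_1(1/4, 3/4; 1; x)), and let alpha_0 = 1/2 - (910/9801)*\sqrt{29}, beta_0 = 1/2 + (910/9801)*\sqrt{29}. Then both series converge and F(alpha_0) / F(beta_0) = 1/\sqrt{29}. -/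
/-- The hypergeometric function `₂F₁(1/4, 3/4; 1; x) = ∑ (1/4)ₙ(3/4)ₙ/(n!)² xⁿ`. -/
noncomputable def F (x : ℝ) : ℝ :=
  ∑' n : ℕ,
    (ascPochhammer ℝ n).eval (1/4) * (ascPochhammer ℝ n).eval (3/4)
      / ((n.factorial : ℝ)) ^ 2 * x ^ n

/-- The element `a + b√2 + c√29 + d√58` of `ℤ[√2, √29]`. -/
@[ext]
structure BiquadInt where
  a : ℤ
  b : ℤ
  c : ℤ
  d : ℤ

namespace BiquadInt

instance : DecidableEq BiquadInt := fun _ _ => decidable_of_iff' _ BiquadInt.ext_iff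

def add (x y : BiquadInt) : BiquadInt := ⟨x.a + y.a, x.b + y.b, x.c + y.c, x.d + y.d⟩

def mul (x y : BiquadInt) : BiquadInt :=
  ⟨x.a * y.a + 2 * (x.b * y.b) + 29 * (x.c * y.c) + 58 * (x.d * y.d),
    x.a * y.b + x.b * y.a + 29 * (x.c * y.d + x.d * y.c),
    x.a * y.c + x.c * y.a + 2 * (x.b * y.d + x.d * y.b),
    x.a * y.d + x.d * y.a + x.b * y.c + x.c * y.b⟩

noncomputable def toReal (x : BiquadInt) : ℝ :=
  x.a + x.b * √2 + x.c * √29 + x.d * (√2 * √29)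

theorem toReal_add (x y : BiquadInt) : (x.add y).toReal = x.toReal + y.toReal := by
  simp only [toReal, add]
  push_cast
  ring

theorem toReal_mul (x y : BiquadInt) : (x.mul y).toReal = x.toReal * y.toReal := by
  have h₂ : √2 ^ 2 = (2 : ℝ) := Real.sq_sqrt (by norm_num)
  have h₂₉ : √29 ^ 2 = (29 : ℝ) := Real.sq_sqrt (by norm_num)
  simp only [toReal, mul]
  push_cast
  linear_combination
    (-(x.b * y.b : ℝ) - (x.b * y.d + x.d * y.b) * √29 - x.d * y.d * √29 ^ 2) * h₂
      + (-(x.c * y.c : ℝ) - (x.c * y.d + x.d * y.c) * √2 - 2 * x.d * y.d) * h₂₉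

/-- `10 ^ 80` times a lower bound for `x`, obtained from the integer parts of
`10 ^ 80 * √2`, `10 ^ 80 * √29` and `10 ^ 80 * √58`. -/
def scaledLower (x : BiquadInt) : ℤ :=
  x.a * 10 ^ 80
    + x.b * 141421356237309504880168872420969807856967187537694807317667973799073247846210703
    + x.c * 538516480713450403125071049154032955629512016164478883768038867001664596282765869
    + x.d * 761577310586390828566141102715832300536070559254659846895048424052035215737300124
    - |x.b| - |x.c| - |x.d|

theorem toReal_pos_of_scaledLower_pos {x : BiquadInt} (h : 0 < x.scaledLower) : 0 < x.toReal := by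
  have approx (k : ℤ) {m s : ℕ} (h₁ : s ^ 2 ≤ m * 10 ^ 160) (h₂ : m * 10 ^ 160 ≤ (s + 1) ^ 2) :
      (k * s - |k| : ℝ) ≤ 10 ^ 80 * (k * √m) := by
    have h₁' : (s : ℝ) ≤ 10 ^ 80 * √m := by
      refine (sq_le_sq₀ (by positivity) (by positivity)).1 ?_
      rw [mul_pow, Real.sq_sqrt (by positivity), mul_comm, ← pow_mul]
      exact_mod_cast h₁
    have h₂' : 10 ^ 80 * √m ≤ (s + 1 : ℝ) := by
      refine (sq_le_sq₀ (by positivity) (by positivity)).1 ?_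
      rw [mul_pow, Real.sq_sqrt (by positivity), mul_comm, ← pow_mul]
      exact_mod_cast h₂
    have h₃ : |(k : ℝ) * (10 ^ 80 * √m - s)| ≤ |(k : ℝ)| * 1 := by
      rw [abs_mul]
      gcongr
      exact abs_le.2 ⟨by linarith, by linarith⟩
    push_cast
    linarith [neg_abs_le ((k : ℝ) * (10 ^ 80 * √m - s))]
  have h₂ := approx x.b (m := 2) (s := 141421356237309504880168872420969807856967187537694807317667973799073247846210703) (by norm_num) (by norm_num)
  have h₂₉ := approx x.c (m := 29) (s := 538516480713450403125071049154032955629512016164478883768038867001664596282765869) (by norm_num) (by norm_num)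
  have h₅₈ := approx x.d (m := 58) (s := 761577310586390828566141102715832300536070559254659846895048424052035215737300124) (by norm_num) (by norm_num)
  have h₂' : √58 = √2 * √29 := by
    rw [← Real.sqrt_mul (by norm_num)]
    norm_num
  have h' : (0 : ℝ) < x.scaledLower := by exact_mod_cast h
  simp only [scaledLower] at h'
  push_cast at h₂ h₂₉ h₅₈ h'
  rw [h₂'] at h₅₈
  simp only [toReal]
  linarith

end BiquadInt

open BiquadInt

/-- The value at `p` of the polynomial with coefficient list `l` (constant term first). -/
noncomputable def evalPoly (l : List BiquadInt) (p : ℝ) : ℝ :=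
  l.foldr (fun x r => x.toReal + p * r) 0

def polyAdd : List BiquadInt → List BiquadInt → List BiquadInt
  | [], q => q
  | x :: p, [] => x :: p
  | x :: p, y :: q => x.add y :: polyAdd p q

def polySMul (x : BiquadInt) (p : List BiquadInt) : List BiquadInt := p.map x.mul

def polyMul : List BiquadInt → List BiquadInt → List BiquadInt
  | [], _ => []
  | x :: p, q => polyAdd (polySMul x q) (⟨0, 0, 0, 0⟩ :: polyMul p q)

def polyDeriv : List BiquadInt → List BiquadInt
  | [] => []
  | _ :: p => polyAdd p (⟨0, 0, 0, 0⟩ :: polyDeriv p)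

def polySub (p q : List BiquadInt) : List BiquadInt := polyAdd p (polySMul ⟨-1, 0, 0, 0⟩ q)

theorem evalPoly_cons (x : BiquadInt) (l : List BiquadInt) (p : ℝ) :
    evalPoly (x :: l) p = x.toReal + p * evalPoly l p := rfl

theorem evalPoly_nil (p : ℝ) : evalPoly [] p = 0 := rfl

theorem toReal_zero : toReal ⟨0, 0, 0, 0⟩ = 0 := by simp [toReal]

theorem evalPoly_add (l m : List BiquadInt) (p : ℝ) :
    evalPoly (polyAdd l m) p = evalPoly l p + evalPoly m p := by
  induction l generalizing m with
  | nil => simp [polyAdd, evalPoly_nil]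
  | cons x l ih =>
    cases m with
    | nil => simp [polyAdd, evalPoly_nil]
    | cons y m =>
      simp only [polyAdd, evalPoly_cons, ih, toReal_add]
      ring

theorem evalPoly_smul (x : BiquadInt) (l : List BiquadInt) (p : ℝ) :
    evalPoly (polySMul x l) p = x.toReal * evalPoly l p := by
  induction l with
  | nil => simp [polySMul, evalPoly_nil]
  | cons y l ih =>
    change (x.mul y).toReal + p * evalPoly (polySMul x l) p = _
    rw [ih, toReal_mul, evalPoly_cons]
    ring

theorem evalPoly_mul (l m : List BiquadInt) (p : ℝ) :
    evalPoly (polyMul l m) p = evalPoly l p * evalPoly m p := by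
  induction l with
  | nil => simp [polyMul, evalPoly_nil]
  | cons x l ih =>
    simp only [polyMul, evalPoly_cons, evalPoly_add, evalPoly_smul, ih, toReal_zero]
    ring

theorem evalPoly_sub (l m : List BiquadInt) (p : ℝ) :
    evalPoly (polySub l m) p = evalPoly l p - evalPoly m p := by
  have h : toReal ⟨-1, 0, 0, 0⟩ = -1 := by simp [toReal]
  rw [polySub, evalPoly_add, evalPoly_smul, h]
  ring

theorem hasDerivAt_evalPoly (l : List BiquadInt) (p : ℝ) :
    HasDerivAt (evalPoly l) (evalPoly (polyDeriv l) p) p := by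
  induction l with
  | nil => exact hasDerivAt_const p 0
  | cons x l ih =>
    convert! ((hasDerivAt_id p).mul ih).const_add x.toReal using 1
    simp only [polyDeriv, evalPoly_add, evalPoly_cons, toReal_zero, id]
    ring

theorem evalPoly_eq_of_sub_eq_zero {l m : List BiquadInt}
    (h : ∀ x ∈ polySub l m, x = ⟨0, 0, 0, 0⟩) (p : ℝ) : evalPoly l p = evalPoly m p := by
  have key (k : List BiquadInt) (hk : ∀ x ∈ k, x = ⟨0, 0, 0, 0⟩) : evalPoly k p = 0 := by
    induction k with
    | nil => rfl
    | cons x k ih =>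
      rw [evalPoly_cons, ih fun y hy => hk y (List.mem_cons_of_mem _ hy),
        hk x List.mem_cons_self, toReal_zero]
      ring
  linarith [key _ h, evalPoly_sub l m p]

theorem evalPoly_nonneg {l : List BiquadInt} (h : ∀ x ∈ l, 0 < x.scaledLower) {p : ℝ}
    (hp : 0 ≤ p) : 0 ≤ evalPoly l p := by
  induction l with
  | nil => exact le_rfl
  | cons x l ih =>
    have h₁ := toReal_pos_of_scaledLower_pos (h x List.mem_cons_self)
    have h₂ := ih fun y hy => h y (List.mem_cons_of_mem _ hy)
    rw [evalPoly_cons]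
    positivity

theorem evalPoly_pos {x : BiquadInt} {l : List BiquadInt} (h : ∀ y ∈ x :: l, 0 < y.scaledLower)
    {p : ℝ} (hp : 0 ≤ p) : 0 < evalPoly (x :: l) p := by
  have h₁ := toReal_pos_of_scaledLower_pos (h x List.mem_cons_self)
  have h₂ := evalPoly_nonneg (fun y hy => h y (List.mem_cons_of_mem _ hy)) hp
  rw [evalPoly_cons]
  positivity

/-- The polynomial `A` in the isogeny `p ↦ p * A(p) ^ 2 / B(p) ^ 2` of degree `29`. -/
def numPoly : List BiquadInt :=
  [⟨37323, -26390, -6930, 4900⟩,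
   ⟨-78653717068584, 55616576704722, 14605628589948, -10327739019444⟩,
   ⟨20694246394923641338227,
     -14633041957395771201786,
     -3842825082624581942988,
     2717287674837596675046⟩,
   ⟨-936215475801715464165000205440,
     662004311591183095460202778116,
     173850849385589068395298672360,
     -122931114515591159509654174560⟩,
   ⟨7902545491691921490684695963467463187,
     -5587943505810537146922958180202589462,
     -1467465857539267955986789467283944054,
     1037655059025748468320980964273704184⟩,
   ⟨-12718175389147119642803225292573480476304232,
     8993108061985786239785598995146390451474838,
     2361705879882732562270213824791879171246148,
     -1669978242833222064845814606576833045005188⟩,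
   ⟨3923988104824130433044932191776368822531382447427,
     -2774678598216491708367840527013086779687314612410,
     -728666298128045736244479991887195142840251900336,
     515244880628439640406723820597863722496404360730⟩,
   ⟨-232399696151309930575540816417738835409012421045011136,
     164331401094284441931139448893870862925792902404053912,
     43155540169061595899269209421155638774735302892449968,
     -30515575099311900049774688015063145934444558916425056⟩,
   ⟨2642519200257613412999019332908470834806522682713142289161,
     -1868543245917810806197916984170911534229608129013136915602,
     -490703496531190157606397509213127407011959270358217857566,
     346979769949154060936674250470419507630000423052418298308⟩,
   ⟨-5765379568620182077366643605744770666272674279953465664731000,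
     4076738989085702846117923275270228312261529960701343500231198,
     1070604108713990098849548176699773395569726871728255464419140,
     -757031425237842134557343112655784243953530433417628176800060⟩,
   ⟨2407108242073910971664209844681905304492989277544485614599217713,
     -1702082561020492034777818120753365921666296626292592872751920990,
     -446988779040683717919759627352724978082489970936653454735668060,
     316068796773962781982348821238778680994870067888717296893754586⟩,
   ⟨-190221340434436877568294447681298635775420481335969262950530738368,
     134506799747585122191262230269923640174902339386580445772955348644,
     35323216140464865553865259850917216613841898843400392857702791144,
     -24977285666240813450271114920293412485231929299402398080808108992⟩,
   ⟨2727643155938940184044446965939489578580968949395119407382219102745,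
     -1928734972221500104280532022420286757580274357057628436743461224130,
     -506510618268402507595912293991351532618737879418739261003215633946,
     358157092920578193079185171869089354664192839205372155978771955040⟩,
   ⟨-6054889468964556113602676074574156451853161802292913575696322103800,
     4281453402839851317539539685631955295713187332844076616490957956026,
     1124364747564043219162173506421013019505831398675034694003249141884,
     -795045937529635652228294589063026690976411354780930797212854851340⟩,
   ⟨1002811801228976763428152316591475568214853777614714353718936748057,
     -709095024902905662070696538408590608227091778341631988541497495150,
     -186217476557153353271901175746169528103680213183984889359669031400,
     131675640449010079407359086276486487149318954284259024542029912166⟩]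

/-- The polynomial `B` in the isogeny `p ↦ p * A(p) ^ 2 / B(p) ^ 2` of degree `29`. -/
def denPoly : List BiquadInt :=
  [⟨1, 0, 0, 0⟩,
   ⟨-2319997680, 1640486094, 430812756, -304630620⟩,
   ⟨1606311040344439945, -1135833429322371384, -298284471854292762, 210918972770818290⟩,
   ⟨-172171827104073207202717200,
     121743866474567985651294508,
     31971505658651778158379000,
     -22607268455976748885486544⟩,
   ⟨3348568826464538632039835049562633,
     -2367795724462954747614631516484760,
     -621813620639466195890785641103140,
     439688627788325894903667061879956⟩,
   ⟨-12326854618318642355918060688863994433920,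
     8716402491313823041279934144242451191674,
     2289039437008033860893613938523576683244,
     -1618595308311817734745236373344330416380⟩,
   ⟨8683669385580882490386201895944163786523771753,
     -6140281508126262659511765515366249612079209760,
     -1612516923173154144056527561378004977845464398,
     1140221651153804372493039932260482395326347270⟩,
   ⟨-1173765779861256619017980214223895881223346888554784,
     829977742464610894948291251496951022627864850557768,
     217962833431987059195410585567807876556738053038992,
     -154122997566391978849454010356733278540130254582784⟩,
   ⟨30460310743353753985941093805191629688267515141900049499,
     -21538692283674885686917812187825651790782835593986899184,
     -5656337704465161369122632999442499081746838643499775832,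
     3999634747508465378308988491146381293112929271091791672⟩,
   ⟨-151737252648379449374254047255763503136395278120035502776560,
     107294440306285526154521894769877232144838720907486920652706,
     28176900444597580293944332755651880223551135903544460784620,
     -19924077377193194865268740393074922412182170781088994435796⟩,
   ⟨144908936987919616561702513871156445762893136615784955449883907,
     -102466091998692079412354105253870683532970822211705870285785272,
     -26908914058848832394556727560508011800504711866503671944470294,
     19027475605378033742116856011553816015829769789574610242893854⟩,
   ⟨-26385464324943917936279140812820006057847167294151623449621147600,
     18657340748923574867435590323643337563946580692970332780470180428,
     4899657720778998290940457281902928830116972355021801662679734008,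
     -3464581199855853312134213867267319614682194439623033663838764720⟩,
   ⟨896394741981407020679288220179584823418940227087590650394689713051,
     -633846800675018500245897039030021322544327634653465256673636949880,
     -166456324752368525603215996373453706034393100376093310469470391364,
     117702396003789945568423487343831829854633026127762618678043711860⟩,
   ⟨-5236362399636514262453096324035657264718331745865740170198001162656,
     3702667361533241612701654686655212981442636597792804725886056149718,
     972368086618101312074370031260792869081147863790543020995041979732,
     -687568067857047654477776824167859068158184211792405220444188254036⟩,
   ⟨3818690976183736820092584868460745417249117041675908399422656595211,
     -2700222284515397155465763629586404535427200855702297894352316320240,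
     -709113112216095311024486276066232776039440664653693808144706385730,
     501418690276298227371809029193943978873018421447690150304249035818⟩]

/-- The square root of the cofactor of the third branch point; see `third_factor`. -/
def thirdPoly : List BiquadInt :=
  [⟨-6930, 4900, 1287, -910⟩,
   ⟨-7588644708942, 5365982133708, 1409175945534, -996437866972⟩,
   ⟨-1601994020732502284406, 1132780835480254971074, 297482821437537045417, -210352120324989296644⟩,
   ⟨-68000268342268965146935978292,
     48083450867323295899094475800,
     12627332825947909374336360660,
     -8928872669527257149832808616⟩,
   ⟨-564559540288109478329196072224719234,
     399203879321282090414572671568901976,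
     104836074754881425424528085337972011,
     -74130299372156478982054599204659762⟩,
   ⟨-904947346547112110165764918305547753977714,
     639894405360235596276908163152755438463620,
     168044503549491729976841533744531749217026,
     -118825408000972457496372206989377139682660⟩,
   ⟨-278952617460862453560212249454754176002260615574,
     197249287436312763233183315008520194703380380614,
     51800200634768635736432765303259321353325362789,
     -36628273135668605887233672786352666570888628584⟩,
   ⟨-16519346986287075998938594026973667848045072240375768,
     11680942274777148736522231724987902176332578310424080,
     3067565725082641104541495619173685929211519463390360,
     -2169096525941364102361669267917798090366366621036336⟩,
   ⟨-187916084163387882038478304464059802945302988617491788166,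
     132876737405953563618416835739515798102580706437510846948,
     34895140797627652796576008676294847956099956754229839525,
     -24674590688461864134988853473639800628628960122655705746⟩,
   ⟨-410861172629601263569739551163484645416523061863896289780818,
     290522721292647789422811172514165526997484321997818633115924,
     76295004395273891552467864396524150491834079598774992038242,
     -53948714978555617263098528338938312623462670710110384632804⟩,
   ⟨-173119499806608156380239656897165730717626942772162628854471602,
     122413972268875830100811081675928201456457397927167159639166222,
     32147484061630166220348775962438725246653848375044798676591595,
     -22731703978065146015978468322164671968964649928997793473418660⟩,
   ⟨-14206989058348841849662372045762621907027340371615080631572143796,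
     10045858303401549373417705275950099446466881220623310294185930840,
     2638171637667763791665284324692043858018796781675920161471016020,
     -1865469054928895190144236525458800282996544413709952884412520360⟩,
   ⟨-235433989621003531960347965985561594399185716428112173544307924710,
     166476970582814845397724564537836540921029121611886993906199354720,
     43718994321044769277000982568157453256421791264362589536455927401,
     -30913997351066917520233337309867441584300716954136904826157366638⟩,
   ⟨-859245181503650175395207720273868965498062952608711783893085135278,
     607578094543096876736650857762841531310172552919524523251265755420,
     159557824556322627838711700113327304573275088758260798227324951582,
     -112824419735149163738258656625773905979467516518820188941828043868⟩,
   ⟨-709113112216095311024486276066232776039440664653693808144706385730,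
     501418690276298227371809029193943978873018421447690150304249035818,
     131678999178749545520433960981405014387900587643996841359401951559,
     -93111113259151626050543573434013949497489684679389582563872976560⟩]

/-- The square root of the cofactor of the branch point `-1`; see `second_factor`. -/
def secondPoly : List BiquadInt :=
  [⟨1, 0, 0, 0⟩,
   ⟨465588634, -329220876, -86457634, 61134780⟩,
   ⟨196071817031885751, -138643711422814398, -36409622370725008, 25745490878781078⟩,
   ⟨18184812048972158990150140,
     -12858603914431049371575608,
     -3376834823120012470506156,
     2387782802375036571263080⟩,
   ⟨340575590829956165525178122351005,
     -240823309782476955916295109709060,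
     -63243299514017953581071638291384,
     44719765950973980492200161265844⟩,
   ⟨1242291148320147339103059037715420392614,
     -878432495185199280703085151733662417252,
     -230687674901667854725124917103558531614,
     163120819259127062948551655616762715908⟩,
   ⟨873278971948516797024965919209359346994478587,
     -617501482932413040397064244174535684924624658,
     -162163834018888014252440013878646905398651048,
     114667146697965458741097966505172517685731162⟩,
   ⟨117989316060376486442266540322845949587780871861960,
     -83431045493855033793093255856727724839734401013072,
     -21910065947110668297029008499666979779576687559784,
     15492756207446409472163670596861966677854562969520⟩,
   ⟨3062252573633001206948227047351031431172373911893067123,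
     -2165339560521852595515626400436578395536614581609095416,
     -568646027244327570665779930736512680870501526852338480,
     402093461959254277645834079084343811376049409456093208⟩,
   ⟨15268438980486882318770033571454578935269442776005796373574,
     -10796416741235290662426474212489185237700156056785884979732,
     -2835277939917192585585238419708769286325039631032559785534,
     2004844257864071536430123159165936688577161528414390110468⟩,
   ⟨14640025628015943640964722675092844068348793118642120442129653,
     -10352061398314917862711275838148816708483595538603583876037506,
     -2718584509915126737751742312129874151751632764955222198236768,
     1922329542189693060937815300250490045816541784940099366665322⟩,
   ⟨2710213299173766617805300685688380078636828187161922735007714940,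
     -1916410202307735654320674581975023231226502650580778244385102328,
     -503273975122016026969816700640864674351178005715472227929717036,
     355868440603487349215420494591495164448572032812546676555819880⟩,
   ⟨98132868926699224491283324456568074672324569713575933525983074223,
     -69390417075359657345855999183473001785108857766730867523760628676,
     -18222816281627716995637588488034476632217209114557107989203015320,
     12885476965055585670113336701848546043026205258537831165361695220⟩,
   ⟨714461094253909682393987818076122301884002569874846302755750259898,
     -505200284640900620596130279938186125779526079005617104111187701244,
     -132672094511826284177020530627896992414506390859828697778211635906,
     93813337703534901023860264708254958776843811143506469126143767484⟩,
   ⟨1002811801228976763428152316591475568214853777614714353718936748057,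
     -709095024902905662070696538408590608227091778341631988541497495150,
     -186217476557153353271901175746169528103680213183984889359669031400,
     131675640449010079407359086276486487149318954284259024542029912166⟩]

theorem denPoly_pos {p : ℝ} (hp : 0 ≤ p) : 0 < evalPoly denPoly p :=
  evalPoly_pos (by decide +kernel) hp

theorem secondPoly_pos {p : ℝ} (hp : 0 ≤ p) : 0 < evalPoly secondPoly p :=
  evalPoly_pos (by decide +kernel) hp

theorem thirdPoly_pos {p : ℝ} (hp : 0 ≤ p) : 0 < evalPoly thirdPoly p :=
  evalPoly_pos (by decide +kernel) hp

theorem denPoly_le_numPoly {p : ℝ} (hp : 0 ≤ p) :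
    evalPoly denPoly p ≤ 6000 * evalPoly numPoly p := by
  have h : 0 ≤ evalPoly (polySub (polySMul ⟨6000, 0, 0, 0⟩ numPoly) denPoly) p :=
    evalPoly_nonneg (by decide +kernel) hp
  rw [evalPoly_sub, evalPoly_smul] at h
  simp only [toReal] at h
  push_cast at h
  linarith

theorem second_factor (p : ℝ) :
    p * evalPoly numPoly p ^ 2 + evalPoly denPoly p ^ 2 = (p + 1) * evalPoly secondPoly p ^ 2 := by
  have h := evalPoly_eq_of_sub_eq_zero
    (l := polyAdd (⟨0, 0, 0, 0⟩ :: polyMul numPoly numPoly) (polyMul denPoly denPoly))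
    (m := polyMul [⟨1, 0, 0, 0⟩, ⟨1, 0, 0, 0⟩] (polyMul secondPoly secondPoly))
    (by decide +kernel) p
  simp only [evalPoly_add, evalPoly_mul, evalPoly_cons, evalPoly_nil, toReal] at h
  push_cast at h
  linarith

theorem third_factor (p : ℝ) :
    (198 + 70 * √2 + 13 * (√2 * √29)) * (p * evalPoly numPoly p ^ 2)
      + (198 - 70 * √2 - 13 * (√2 * √29)) * evalPoly denPoly p ^ 2
      = ((198 - 70 * √2 + 13 * (√2 * √29)) * p + (198 + 70 * √2 - 13 * (√2 * √29)))
        * evalPoly thirdPoly p ^ 2 := by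
  have h := evalPoly_eq_of_sub_eq_zero
    (l := polyAdd (polySMul ⟨198, 70, 0, 13⟩ (⟨0, 0, 0, 0⟩ :: polyMul numPoly numPoly))
      (polySMul ⟨198, -70, 0, -13⟩ (polyMul denPoly denPoly)))
    (m := polyMul [⟨198, 70, 0, -13⟩, ⟨198, -70, 0, 13⟩] (polyMul thirdPoly thirdPoly))
    (by decide +kernel) p
  simp only [evalPoly_add, evalPoly_mul, evalPoly_smul, evalPoly_cons, evalPoly_nil, toReal] at h
  push_cast at h
  linarith

theorem wronskian_factor (p : ℝ) :
    evalPoly numPoly p * evalPoly denPoly p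
      + 2 * p * (evalPoly (polyDeriv numPoly) p * evalPoly denPoly p
        - evalPoly numPoly p * evalPoly (polyDeriv denPoly) p)
      = √29 * evalPoly thirdPoly p * evalPoly secondPoly p := by
  have h := evalPoly_eq_of_sub_eq_zero
    (l := polyAdd (polyMul numPoly denPoly) (polySMul ⟨2, 0, 0, 0⟩ (⟨0, 0, 0, 0⟩ ::
      polySub (polyMul (polyDeriv numPoly) denPoly) (polyMul numPoly (polyDeriv denPoly)))))
    (m := polySMul ⟨0, 0, 1, 0⟩ (polyMul thirdPoly secondPoly))
    (by decide +kernel) p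
  simp only [evalPoly_add, evalPoly_sub, evalPoly_mul, evalPoly_smul, evalPoly_cons,
    toReal] at h
  push_cast at h
  linarith

open MeasureTheory Set Filter Topology

theorem image_Ioi_zero_eq {f : ℝ → ℝ} (hf : Continuous f) (hmono : StrictMonoOn f (Ici 0))
    (h₀ : f 0 = 0) (htop : Tendsto f atTop atTop) : f '' Ioi 0 = Ioi 0 := by
  ext y
  constructor
  · rintro ⟨x, hx, rfl⟩
    have := hmono self_mem_Ici (mem_Ici.2 (le_of_lt hx)) hx
    rwa [h₀] at this
  · intro hy
    obtain ⟨z, hz₀, hz⟩ := ((eventually_ge_atTop 0).and (htop.eventually_ge_atTop y)).exists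
    obtain ⟨x, hx, rfl⟩ := intermediate_value_Icc hz₀ hf.continuousOn
      ⟨h₀.trans_le (le_of_lt hy), hz⟩
    refine ⟨x, lt_of_le_of_ne hx.1 fun h => ?_, rfl⟩
    rw [← h, h₀] at hy
    exact lt_irrefl (0 : ℝ) (mem_Ioi.1 hy)

/-- A complete elliptic integral in Legendre form with parameter `κ`. -/
noncomputable def ellipticPeriod (κ : ℝ) : ℝ :=
  ∫ t in Ioi (0 : ℝ), (√((t ^ 2 + 1) * ((1 + κ) * t ^ 2 + (1 - κ))))⁻¹

/-- The effect on `t = √p` of an isogeny of degree `29`. -/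
noncomputable def isogeny (t : ℝ) : ℝ :=
  t * evalPoly numPoly (t ^ 2) / evalPoly denPoly (t ^ 2)

theorem hasDerivAt_isogeny (t : ℝ) : HasDerivAt isogeny
    (√29 * (evalPoly thirdPoly (t ^ 2) * evalPoly secondPoly (t ^ 2)
      / evalPoly denPoly (t ^ 2) ^ 2)) t := by
  have hB := denPoly_pos (sq_nonneg t)
  have hsq : HasDerivAt (fun t : ℝ => t ^ 2) (2 * t) t := by simpa using hasDerivAt_pow 2 t
  have hN := (hasDerivAt_evalPoly numPoly (t ^ 2)).comp t hsq
  have hD := (hasDerivAt_evalPoly denPoly (t ^ 2)).comp t hsq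
  convert! ((hasDerivAt_id t).mul hN).div hD hB.ne' using 1
  simp only [Function.comp_apply, id, Pi.mul_apply]
  field_simp
  linear_combination -wronskian_factor (t ^ 2)

theorem continuous_isogeny : Continuous isogeny :=
  continuous_iff_continuousAt.2 fun t => (hasDerivAt_isogeny t).continuousAt

theorem strictMono_isogeny : StrictMono isogeny := by
  refine strictMono_of_hasDerivAt_pos hasDerivAt_isogeny fun t => ?_
  have := denPoly_pos (sq_nonneg t)
  have := secondPoly_pos (sq_nonneg t)
  have := thirdPoly_pos (sq_nonneg t)
  positivity

theorem tendsto_isogeny : Tendsto isogeny atTop atTop := by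
  refine tendsto_atTop_mono' _ ?_ (tendsto_id.atTop_div_const (r := 6000) (by norm_num))
  filter_upwards [eventually_ge_atTop 0] with t ht
  have h := denPoly_le_numPoly (sq_nonneg t)
  rw [isogeny, id, div_le_div_iff₀ (by norm_num) (denPoly_pos (sq_nonneg t))]
  nlinarith

theorem ellipticPeriod_isogeny :
    ellipticPeriod ((70 * √2 + 13 * (√2 * √29)) / 198)
      = √29 * ellipticPeriod ((13 * (√2 * √29) - 70 * √2) / 198) := by
  have himage := image_Ioi_zero_eq continuous_isogeny (strictMono_isogeny.strictMonoOn _)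
    (by simp [isogeny]) tendsto_isogeny
  rw [ellipticPeriod, ellipticPeriod, ← himage,
    integral_image_eq_integral_abs_deriv_smul measurableSet_Ioi
      (fun t _ => (hasDerivAt_isogeny t).hasDerivWithinAt) strictMono_isogeny.injective.injOn,
    himage, ← integral_const_mul]
  refine setIntegral_congr_fun measurableSet_Ioi fun t _ => ?_
  have hB := denPoly_pos (sq_nonneg t)
  have hC := thirdPoly_pos (sq_nonneg t)
  have hD := secondPoly_pos (sq_nonneg t)
  have h₂ := second_factor (t ^ 2)
  have h₃ := third_factor (t ^ 2)
  simp only [isogeny]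
  set A := evalPoly numPoly (t ^ 2)
  set B := evalPoly denPoly (t ^ 2)
  set C := evalPoly thirdPoly (t ^ 2)
  set D := evalPoly secondPoly (t ^ 2)
  have h₂' : (t * A / B) ^ 2 + 1 = (t ^ 2 + 1) * (D / B) ^ 2 := by
    field_simp
    linear_combination h₂
  have h₃' : (1 + (70 * √2 + 13 * (√2 * √29)) / 198) * (t * A / B) ^ 2
      + (1 - (70 * √2 + 13 * (√2 * √29)) / 198)
      = ((1 + (13 * (√2 * √29) - 70 * √2) / 198) * t ^ 2
        + (1 - (13 * (√2 * √29) - 70 * √2) / 198)) * (C / B) ^ 2 := by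
    field_simp
    linear_combination h₃
  have hpos : 0 < C * D / B ^ 2 := by positivity
  rw [h₂', h₃', mul_mul_mul_comm, ← mul_pow, div_mul_div_comm, mul_comm D C, ← pow_two,
    Real.sqrt_mul' _ (sq_nonneg _), Real.sqrt_sq hpos.le, abs_of_pos (by positivity), smul_eq_mul,
    mul_inv, mul_assoc, mul_left_comm _ _ (C * D / B ^ 2)⁻¹, mul_inv_cancel₀ hpos.ne', mul_one]

theorem ellipticPeriod_eq_integral_cos (κ : ℝ) :
    2 * ellipticPeriod κ = ∫ θ in (0)..Real.pi, (√(1 - κ * Real.cos θ))⁻¹ := by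
  have hderiv (t : ℝ) : HasDerivAt (fun t => 2 * Real.arctan t) (2 * (1 / (1 + t ^ 2))) t :=
    (Real.hasDerivAt_arctan t).const_mul 2
  have himage : (fun t => 2 * Real.arctan t) '' Ioi 0 = Ioo 0 Real.pi := by
    ext y
    constructor
    · rintro ⟨t, ht, rfl⟩
      exact ⟨mul_pos two_pos (Real.arctan_pos.2 ht), by linarith [Real.arctan_lt_pi_div_two t]⟩
    · rintro ⟨h₀, hπ⟩
      refine ⟨Real.tan (y / 2), Real.tan_pos_of_pos_of_lt_pi_div_two (by linarith) (by linarith), ?_⟩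
      simp only
      rw [Real.arctan_tan (by linarith) (by linarith)]
      ring
  have hinj : InjOn (fun t => 2 * Real.arctan t) (Ioi 0) := fun s _ t _ h =>
    Real.arctan_injective (mul_left_cancel₀ two_ne_zero h)
  rw [intervalIntegral.integral_of_le Real.pi_pos.le, integral_Ioc_eq_integral_Ioo, ← himage,
    integral_image_eq_integral_abs_deriv_smul measurableSet_Ioi
      (fun t _ => (hderiv t).hasDerivWithinAt) hinj, ellipticPeriod, ← integral_const_mul]
  refine setIntegral_congr_fun measurableSet_Ioi fun t _ => ?_
  have ht : 0 < 1 + t ^ 2 := by positivity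
  have hcos : 1 - κ * Real.cos (2 * Real.arctan t)
      = (t ^ 2 + 1) * ((1 + κ) * t ^ 2 + (1 - κ)) / (1 + t ^ 2) ^ 2 := by
    rw [Real.cos_two_mul, Real.cos_sq_arctan]
    field_simp
    ring
  rw [hcos, Real.sqrt_div' _ (by positivity), Real.sqrt_sq ht.le, abs_of_pos (by positivity),
    smul_eq_mul, inv_div]
  field_simp

theorem integral_cos_pow_add_two (n : ℕ) :
    ∫ θ in (0)..Real.pi, Real.cos θ ^ (n + 2)
      = (n + 1) / (n + 2) * ∫ θ in (0)..Real.pi, Real.cos θ ^ n := by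
  rw [integral_cos_pow]
  simp

theorem integral_cos_pow_odd (n : ℕ) :
    ∫ θ in (0)..Real.pi, Real.cos θ ^ (2 * n + 1) = 0 := by
  induction n with
  | zero => simp
  | succ n ih => rw [show 2 * (n + 1) + 1 = 2 * n + 1 + 2 by ring,
      integral_cos_pow_add_two, ih, mul_zero]

theorem choose_succ_real (a : ℝ) (n : ℕ) :
    Ring.choose a (n + 1) = Ring.choose a n * ((a - n) / (n + 1)) := by
  rw [Ring.choose_eq_smul, Ring.choose_eq_smul, descPochhammer_succ_right, Polynomial.smeval_mul,
    Nat.factorial_succ]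
  simp only [Polynomial.smeval_sub, Polynomial.smeval_X, Polynomial.smeval_natCast, pow_one,
    pow_zero, smul_eq_mul, nsmul_eq_mul, mul_one]
  push_cast
  field_simp

theorem choose_mul_integral_cos_pow (n : ℕ) :
    Ring.choose (-1 / 2 : ℝ) (2 * n) * ∫ θ in (0)..Real.pi, Real.cos θ ^ (2 * n)
      = Real.pi * ((ascPochhammer ℝ n).eval (1/4) * (ascPochhammer ℝ n).eval (3/4)
        / ((n.factorial : ℝ)) ^ 2) := by
  induction n with
  | zero => simp
  | succ n ih =>
    rw [show 2 * (n + 1) = 2 * n + 1 + 1 by ring, choose_succ_real, choose_succ_real,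
      integral_cos_pow_add_two, ascPochhammer_succ_eval, ascPochhammer_succ_eval,
      Nat.factorial_succ]
    push_cast
    calc _ = (Ring.choose (-1 / 2 : ℝ) (2 * n) * ∫ θ in (0)..Real.pi, Real.cos θ ^ (2 * n))
          * ((-1 / 2 - 2 * n) / (2 * n + 1) * ((-1 / 2 - (2 * n + 1)) / (2 * n + 1 + 1))
            * ((2 * n + 1) / (2 * n + 2))) := by ring
      _ = _ := by
        rw [ih]
        field_simp
        ring

theorem hasSum_inv_sqrt {z : ℝ} (hz : |z| < 1) :
    HasSum (fun n => Ring.choose (-1 / 2 : ℝ) n * z ^ n) (√(1 + z))⁻¹ := by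
  have h := (Real.one_add_rpow_hasFPowerSeriesOnBall_zero (a := -1 / 2)).hasSum
    (y := z) (by simpa [enorm_eq_nnnorm] using! hz)
  have h0 : (0 : ℝ) ≤ 1 + z := by linarith [neg_abs_le z]
  simp only [zero_add, binomialSeries_apply] at h
  convert! h using 1
  · ext n
    simp
  · rw [Real.sqrt_eq_rpow, ← Real.rpow_neg h0]
    norm_num

theorem hasSum_integral_cos {κ : ℝ} (h₀ : 0 ≤ κ) (h₁ : κ < 1) :
    HasSum (fun n : ℕ => Real.pi * ((ascPochhammer ℝ n).eval (1/4) * (ascPochhammer ℝ n).eval (3/4)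
        / ((n.factorial : ℝ)) ^ 2 * (κ ^ 2) ^ n))
      (∫ θ in (0)..Real.pi, (√(1 - κ * Real.cos θ))⁻¹) := by
  have hκ : |κ| < 1 := by rwa [abs_of_nonneg h₀]
  have hle (θ : ℝ) : |-(κ * Real.cos θ)| ≤ κ := by
    rw [abs_neg, abs_mul, abs_of_nonneg h₀]
    exact mul_le_of_le_one_right h₀ (Real.abs_cos_le_one θ)
  have hsum : HasSum (fun n => ∫ θ in (0)..Real.pi,
      Ring.choose (-1 / 2 : ℝ) n * (-(κ * Real.cos θ)) ^ n)
      (∫ θ in (0)..Real.pi, (√(1 - κ * Real.cos θ))⁻¹) := by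
    refine intervalIntegral.hasSum_integral_of_dominated_convergence
      (fun n _ => |Ring.choose (-1 / 2 : ℝ) n * κ ^ n|) ?_ ?_ ?_ ?_ ?_
    · exact fun n => Continuous.aestronglyMeasurable (by fun_prop)
    · refine fun n => Eventually.of_forall fun θ _ => ?_
      rw [Real.norm_eq_abs, abs_mul, abs_mul, abs_pow, abs_pow]
      exact mul_le_mul_of_nonneg_left
        (pow_le_pow_left₀ (abs_nonneg _) ((hle θ).trans (le_abs_self κ)) n) (abs_nonneg _)
    · exact Eventually.of_forall fun θ _ => (hasSum_inv_sqrt hκ).summable.abs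
    · exact intervalIntegrable_const
    · refine Eventually.of_forall fun θ _ => ?_
      rw [sub_eq_add_neg]
      exact hasSum_inv_sqrt ((hle θ).trans_lt h₁)
  have hinj : Function.Injective (fun n : ℕ => 2 * n) := mul_right_injective₀ two_ne_zero
  have hterm (n : ℕ) : ∫ θ in (0)..Real.pi, Ring.choose (-1 / 2 : ℝ) n * (-(κ * Real.cos θ)) ^ n
      = (-κ) ^ n * (Ring.choose (-1 / 2 : ℝ) n * ∫ θ in (0)..Real.pi, Real.cos θ ^ n) := by
    rw [← intervalIntegral.integral_const_mul, ← intervalIntegral.integral_const_mul]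
    congr 1
    ext θ
    rw [← neg_mul, mul_pow]
    ring
  rw [← hinj.hasSum_iff] at hsum
  · convert! hsum using 1
    ext n
    simp only [Function.comp_apply]
    rw [hterm, choose_mul_integral_cos_pow, pow_mul, neg_sq]
    ring
  · intro n hn
    obtain ⟨k, rfl | rfl⟩ := n.even_or_odd'
    · exact absurd ⟨k, rfl⟩ hn
    · rw [hterm, integral_cos_pow_odd, mul_zero, mul_zero]

theorem hasSum_F {κ : ℝ} (h₀ : 0 ≤ κ) (h₁ : κ < 1) :
    HasSum (fun n : ℕ => (ascPochhammer ℝ n).eval (1/4) * (ascPochhammer ℝ n).eval (3/4)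
      / ((n.factorial : ℝ)) ^ 2 * (κ ^ 2) ^ n) (2 / Real.pi * ellipticPeriod κ) := by
  have h := (hasSum_integral_cos h₀ h₁).mul_left Real.pi⁻¹
  rw [← ellipticPeriod_eq_integral_cos] at h
  simp only [inv_mul_cancel_left₀ Real.pi_ne_zero] at h
  rwa [← mul_assoc, inv_mul_eq_div] at h

theorem one_le_F {x : ℝ} (hx : 0 ≤ x) (hs : Summable fun n : ℕ =>
      (ascPochhammer ℝ n).eval (1/4) * (ascPochhammer ℝ n).eval (3/4)
        / ((n.factorial : ℝ)) ^ 2 * x ^ n) : 1 ≤ F x := by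
  have h := hs.le_tsum 0 fun n _ => by
    have := (ascPochhammer_pos n (1/4 : ℝ) (by norm_num)).le
    have := (ascPochhammer_pos n (3/4 : ℝ) (by norm_num)).le
    positivity
  simpa [F] using h

/-- The Ramanujan multiplier of level 2 at the degree-29 singular values: with
`α₀ = 1/2 - (910/9801)√29` and `β₀ = 1/2 + (910/9801)√29`, the series defining
`F(α₀)` and `F(β₀)` both converge, and `F(α₀)/F(β₀) = 1/√29`. -/
theorem multiplier_value :
    (Summable fun n : ℕ =>
      (ascPochhammer ℝ n).eval (1/4) * (ascPochhammer ℝ n).eval (3/4)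
        / ((n.factorial : ℝ)) ^ 2 * (1/2 - (910/9801) * Real.sqrt 29) ^ n) ∧
    (Summable fun n : ℕ =>
      (ascPochhammer ℝ n).eval (1/4) * (ascPochhammer ℝ n).eval (3/4)
        / ((n.factorial : ℝ)) ^ 2 * (1/2 + (910/9801) * Real.sqrt 29) ^ n) ∧
    F (1/2 - (910/9801) * Real.sqrt 29) / F (1/2 + (910/9801) * Real.sqrt 29)
      = 1 / Real.sqrt 29 := by
  have h₂ : √2 ^ 2 = (2 : ℝ) := Real.sq_sqrt (by norm_num)
  have h₂₉ : √29 ^ 2 = (29 : ℝ) := Real.sq_sqrt (by norm_num)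
  have pos₂ : 0 < √2 := by positivity
  have pos₂₉ : 0 < √29 := by positivity
  have hα : 1/2 - (910/9801) * √29 = ((13 * (√2 * √29) - 70 * √2) / 198) ^ 2 := by
    linear_combination (-(13 * √29 - 70) ^ 2 / 198 ^ 2) * h₂ - 338 / 198 ^ 2 * h₂₉
  have hβ : 1/2 + (910/9801) * √29 = ((70 * √2 + 13 * (√2 * √29)) / 198) ^ 2 := by
    linear_combination (-(13 * √29 + 70) ^ 2 / 198 ^ 2) * h₂ - 338 / 198 ^ 2 * h₂₉
  have hα₀ : 0 ≤ (13 * (√2 * √29) - 70 * √2) / 198 := by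
    have : 70 / 13 ≤ √29 := Real.le_sqrt_of_sq_le (by norm_num)
    have : 0 ≤ √2 * (13 * √29 - 70) := mul_nonneg pos₂.le (by linarith)
    linarith
  have hβ₀ : 0 ≤ (70 * √2 + 13 * (√2 * √29)) / 198 := by positivity
  have hβ₁ : (70 * √2 + 13 * (√2 * √29)) / 198 < 1 := by
    refine (sq_lt_one_iff₀ hβ₀).1 ?_
    rw [← hβ]
    have : √29 < 9801 / 1820 := (Real.sqrt_lt' (by norm_num)).2 (by norm_num)
    linarith
  have hα₁ : (13 * (√2 * √29) - 70 * √2) / 198 < 1 := by linarith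
  have sα := hasSum_F hα₀ hα₁
  have sβ := hasSum_F hβ₀ hβ₁
  rw [hα, hβ]
  refine ⟨sα.summable, sβ.summable, ?_⟩
  have hF := one_le_F (sq_nonneg _) sα.summable
  have eα : F _ = _ := sα.tsum_eq
  have eβ : F _ = _ := sβ.tsum_eq
  have key : F (((70 * √2 + 13 * (√2 * √29)) / 198) ^ 2)
      = √29 * F (((13 * (√2 * √29) - 70 * √2) / 198) ^ 2) := by
    rw [eα, eβ, ellipticPeriod_isogeny]
    ring
  rw [key, div_mul_cancel_right₀ (by positivity), one_div]
end
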